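/- arXiv:2306.15097 — 2 statements merged into one kernel-verified Lean document; each statement's English description precedes it below -/
import Mathlib

section
/- Let w, h > 0 and let C be a convex subset of the axis-aligned rectangle B = [0,w] × [0,h] in the Euclidean plane whose Lebesgue area equals wh/2. Let x₀ = (w/2, h/2) be the center of B. Then ∫_C ‖x − x₀‖ dx ≤ (1/2)·FW_rect(w,h), where FW_rect(w,h) = (1/6)·h·w·√(h² + w²) + (1/12)·w³·log((√(h² + w²) + h)/w) + (1/12)·h³·log((√(h² + w²) + w)/h) is the Fermat–Weber value of the rectangle [−w/2,w/2] × [−h/2,h/2] relative to its center. -/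
open MeasureTheory Real

noncomputable def FWrect (w h : ℝ) : ℝ :=
  1 / 6 * h * w * Real.sqrt (h ^ 2 + w ^ 2)
    + 1 / 12 * w ^ 3 * Real.log ((Real.sqrt (h ^ 2 + w ^ 2) + h) / w)
    + 1 / 12 * h ^ 3 * Real.log ((Real.sqrt (h ^ 2 + w ^ 2) + w) / h)

open Set
open scoped ENNReal

/-- The rectangle `[-a, a] × [-b, b]`. -/
def centeredRect (a b : ℝ) : Set (ℝ × ℝ) := Icc (-a) a ×ˢ Icc (-b) b

lemma isCompact_centeredRect (a b : ℝ) : IsCompact (centeredRect a b) :=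
  isCompact_Icc.prod isCompact_Icc

lemma convex_prodMk_preimage {C : Set (ℝ × ℝ)} (hC : Convex ℝ C) (t : ℝ) :
    Convex ℝ (Prod.mk t ⁻¹' C) := by
  intro x hx y hy α β hα hβ hαβ
  have := hC hx hy hα hβ hαβ
  have e : α • (t, x) + β • (t, y) = (t, α • x + β • y) := by
    ext <;> simp [← add_mul, hαβ]
  rwa [e] at this

/-- A combination of opposite slices of a convex set fits in the slices nearer to the axis. -/
lemma ofReal_le_volume_slice {C : Set (ℝ × ℝ)} (hC : Convex ℝ C) {t u p q p' q' α β : ℝ}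
    (hα : 0 ≤ α) (hβ : 0 ≤ β) (hαβ : α + β = 1)
    (hp : (t, p) ∈ C) (hq : (t, q) ∈ C) (hp' : (u, p') ∈ C) (hq' : (u, q') ∈ C) :
    ENNReal.ofReal (α * (q - p) + β * (q' - p')) ≤
      volume (Prod.mk (α * t + β * u) ⁻¹' C) := by
  have h1 : (α * t + β * u, α * p + β * p') ∈ C := by
    simpa using hC hp hp' hα hβ hαβ
  have h2 : (α * t + β * u, α * q + β * q') ∈ C := by
    simpa using hC hq hq' hα hβ hαβ
  have h3 := (convex_prodMk_preimage hC (α * t + β * u)).ordConnected.out h1 h2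
  have h4 := measure_mono (μ := volume) h3
  rw [Real.volume_Icc] at h4
  convert h4 using 2
  ring

/-- Total length of two opposite vertical slices. -/
noncomputable def sliceSum (C : Set (ℝ × ℝ)) (t : ℝ) : ℝ≥0∞ :=
  volume (Prod.mk t ⁻¹' C) + volume (Prod.mk (-t) ⁻¹' C)

lemma sliceSum_le_of_abs_lt {C : Set (ℝ × ℝ)} (hC : Convex ℝ C) (hcomp : IsCompact C)
    {s t : ℝ} (hst : |s| < |t|) (h1 : (Prod.mk t ⁻¹' C).Nonempty)
    (h2 : (Prod.mk (-t) ⁻¹' C).Nonempty) : sliceSum C t ≤ sliceSum C s := by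
  have hc : ∀ u, IsCompact (Prod.mk u ⁻¹' C) := fun u =>
    (hcomp.image continuous_snd).of_isClosed_subset
      (hcomp.isClosed.preimage (by fun_prop)) fun y hy => ⟨_, hy, rfl⟩
  obtain ⟨p, hp⟩ := (hc t).exists_isLeast h1
  obtain ⟨q, hq⟩ := (hc t).exists_isGreatest h1
  obtain ⟨p', hp'⟩ := (hc (-t)).exists_isLeast h2
  obtain ⟨q', hq'⟩ := (hc (-t)).exists_isGreatest h2
  have hpq : p ≤ q := hp.2 hq.1
  have hpq' : p' ≤ q' := hp'.2 hq'.1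
  have ht0 : t ≠ 0 := by
    rintro rfl
    simp at hst
    exact absurd hst (not_lt.2 (abs_nonneg s))
  have hr : |s / t| ≤ 1 := by
    rw [abs_div]
    exact div_le_one_of_le₀ hst.le (abs_nonneg _)
  rw [abs_le] at hr
  set α := (1 + s / t) / 2 with hα
  set β := (1 - s / t) / 2 with hβ
  have hα0 : 0 ≤ α := by linarith
  have hβ0 : 0 ≤ β := by linarith
  have hαβ : α + β = 1 := by ring
  have e1 : α * t + β * (-t) = s := by rw [hα, hβ]; field_simp; ring
  have e2 : β * t + α * (-t) = -s := by rw [hα, hβ]; field_simp; ring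
  have k1 := ofReal_le_volume_slice hC hα0 hβ0 hαβ hp.1 hq.1 hp'.1 hq'.1
  have k2 := ofReal_le_volume_slice hC hβ0 hα0 (by linarith) hp.1 hq.1 hp'.1 hq'.1
  rw [e1] at k1
  rw [e2] at k2
  have m1 : volume (Prod.mk t ⁻¹' C) ≤ ENNReal.ofReal (q - p) := by
    rw [← Real.volume_Icc]
    exact measure_mono fun y hy => ⟨hp.2 hy, hq.2 hy⟩
  have m2 : volume (Prod.mk (-t) ⁻¹' C) ≤ ENNReal.ofReal (q' - p') := by
    rw [← Real.volume_Icc]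
    exact measure_mono fun y hy => ⟨hp'.2 hy, hq'.2 hy⟩
  refine (add_le_add m1 m2).trans (le_trans (le_of_eq ?_) (add_le_add k1 k2))
  have n1 : 0 ≤ q - p := by linarith
  have n2 : 0 ≤ q' - p' := by linarith
  rw [← ENNReal.ofReal_add n1 n2, ← ENNReal.ofReal_add (by positivity) (by positivity)]
  congr 1
  linear_combination (-(q - p) - (q' - p')) * hαβ

lemma volume_slice_le {C : Set (ℝ × ℝ)} {a b : ℝ} (hsub : C ⊆ centeredRect a b) (t : ℝ) :
    volume (Prod.mk t ⁻¹' C) ≤ ENNReal.ofReal (2 * b) := by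
  have : volume (Prod.mk t ⁻¹' C) ≤ volume (Icc (-b) b) :=
    measure_mono fun y hy => (hsub hy).2
  rwa [Real.volume_Icc, show b - -b = 2 * b by ring] at this

lemma two_mul_volume_inter_fst {C : Set (ℝ × ℝ)} (hC : MeasurableSet C) {J : Set ℝ}
    (hJ : MeasurableSet J) (hneg : -J = J) :
    2 * volume (C ∩ Prod.fst ⁻¹' J) = ∫⁻ t in J, sliceSum C t := by
  have hm : Measurable fun t => volume (Prod.mk t ⁻¹' C) := measurable_measure_prodMk_left hC
  have e1 : volume (C ∩ Prod.fst ⁻¹' J) = ∫⁻ t in J, volume (Prod.mk t ⁻¹' C) := by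
    rw [Measure.volume_eq_prod, Measure.prod_apply (hC.inter (measurable_fst hJ)),
      ← lintegral_indicator hJ]
    congr with t
    by_cases ht : t ∈ J
    · rw [indicator_of_mem ht]
      congr 1
      ext y
      simp [ht]
    · rw [indicator_of_notMem ht]
      convert measure_empty (μ := (volume : Measure ℝ))
      ext y
      simp [ht]
  have e2 : ∫⁻ t in J, volume (Prod.mk (-t) ⁻¹' C) = ∫⁻ t in J, volume (Prod.mk t ⁻¹' C) := by
    rw [← (Measure.measurePreserving_neg (volume : Measure ℝ)).setLIntegral_comp_preimage hJ hm]
    congr 2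
    simpa using hneg.symm
  unfold sliceSum
  rw [lintegral_add_left hm, e2, ← e1, two_mul]

/-- A convex set with at least half the area of a centered rectangle
occupies at least half of each vertical strip that is symmetric about the center. -/
lemma volume_strip_le {C : Set (ℝ × ℝ)} {a b : ℝ} (hC : Convex ℝ C) (hclosed : IsClosed C)
    (hsub : C ⊆ centeredRect a b) (hvol : volume (centeredRect a b) ≤ 2 * volume C)
    {J : Set ℝ} (hJ : MeasurableSet J) (hJs : ∀ s ∈ J, ∀ t, |t| ≤ |s| → t ∈ J) :
    volume (centeredRect a b ∩ Prod.fst ⁻¹' J) ≤ 2 * volume (C ∩ Prod.fst ⁻¹' J) := by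
  have hcomp : IsCompact C := (isCompact_centeredRect a b).of_isClosed_subset hclosed hsub
  have hneg : -J = J := by
    ext t
    exact ⟨fun h => hJs _ h _ (by simp), fun h => hJs _ h _ (by simp)⟩
  have hI : -Icc (-a) a = Icc (-a) a := by simp
  have hJI : -(Icc (-a) a ∩ J) = Icc (-a) a ∩ J := by rw [inter_neg, hI, hneg]
  have hrect : ∀ K : Set ℝ, volume (centeredRect a b ∩ Prod.fst ⁻¹' K) =
      volume (Icc (-a) a ∩ K) * ENNReal.ofReal (2 * b) := by
    intro K
    have : centeredRect a b ∩ Prod.fst ⁻¹' K = (Icc (-a) a ∩ K) ×ˢ Icc (-b) b := by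
      ext ⟨x, y⟩
      simp only [centeredRect, mem_inter_iff, mem_prod, mem_preimage]
      tauto
    rw [this, Measure.volume_eq_prod, Measure.prod_prod, Real.volume_Icc,
      show b - -b = 2 * b by ring]
  have hCK : ∀ K : Set ℝ, C ∩ Prod.fst ⁻¹' K = C ∩ Prod.fst ⁻¹' (Icc (-a) a ∩ K) := by
    intro K
    ext z
    simp only [mem_inter_iff, mem_preimage]
    exact ⟨fun h => ⟨h.1, (hsub h.1).1, h.2⟩, fun h => ⟨h.1, h.2.2⟩⟩
  have hmI : MeasurableSet (Icc (-a) a ∩ J) := measurableSet_Icc.inter hJ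
  rw [hrect, hCK, two_mul_volume_inter_fst hclosed.measurableSet hmI hJI]
  set M := ENNReal.ofReal (2 * b) with hM
  by_cases hcase : ∀ s ∈ J, M ≤ sliceSum C s
  · calc volume (Icc (-a) a ∩ J) * M = ∫⁻ _ in Icc (-a) a ∩ J, M := by
          rw [setLIntegral_const, mul_comm]
      _ ≤ _ := setLIntegral_mono' hmI fun s hs => hcase s hs.2
  · push Not at hcase
    obtain ⟨s, hsJ, hs⟩ := hcase
    have hout : ∀ t, t ∉ J → sliceSum C t ≤ M := by
      intro t htJ
      by_contra! hlt
      have habs : |s| < |t| := by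
        by_contra! hle
        exact htJ (hJs s hsJ t hle)
      have h1 : (Prod.mk t ⁻¹' C).Nonempty := by
        by_contra hne
        rw [not_nonempty_iff_eq_empty] at hne
        rw [sliceSum, hne, measure_empty, zero_add] at hlt
        exact absurd (volume_slice_le hsub (-t)) (not_le.2 hlt)
      have h2 : (Prod.mk (-t) ⁻¹' C).Nonempty := by
        by_contra hne
        rw [not_nonempty_iff_eq_empty] at hne
        rw [sliceSum, hne, measure_empty, add_zero] at hlt
        exact absurd (volume_slice_le hsub t) (not_le.2 hlt)
      exact absurd ((sliceSum_le_of_abs_lt hC hcomp habs h1 h2).trans hs.le) (not_le.2 hlt)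
    have hfin : volume (Icc (-a) a \ J) * M ≠ ∞ :=
      ENNReal.mul_ne_top (measure_ne_top_of_subset sdiff_subset (by simp)) ENNReal.ofReal_ne_top
    have htot : volume (Icc (-a) a) * M ≤ ∫⁻ t in Icc (-a) a, sliceSum C t := by
      have := hrect univ
      rw [preimage_univ, inter_univ, inter_univ] at this
      rw [← two_mul_volume_inter_fst hclosed.measurableSet measurableSet_Icc hI, ← this]
      refine hvol.trans (le_of_eq ?_)
      congr 2
      exact (inter_eq_left.2 fun z hz => (hsub hz).1).symm
    rw [← measure_inter_add_sdiff _ hJ, add_mul, ← lintegral_inter_add_sdiff _ _ hJ] at htot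
    have hle : ∫⁻ t in Icc (-a) a \ J, sliceSum C t ≤ volume (Icc (-a) a \ J) * M := by
      calc _ ≤ ∫⁻ _ in Icc (-a) a \ J, M :=
            setLIntegral_mono' (measurableSet_Icc.diff hJ) fun t ht => hout t ht.2
        _ = _ := by rw [setLIntegral_const, mul_comm]
    exact (ENNReal.add_le_add_iff_right hfin).1 (htot.trans (add_le_add_right hle _))

lemma swap_preimage_centeredRect (a b : ℝ) :
    Prod.swap ⁻¹' centeredRect a b = centeredRect b a := by
  ext ⟨x, y⟩
  simp only [centeredRect, mem_preimage, mem_prod, Prod.swap]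
  tauto

lemma volume_swap_preimage (S : Set (ℝ × ℝ)) : volume (Prod.swap ⁻¹' S) = volume S :=
  (Measure.measurePreserving_swap (μ := (volume : Measure ℝ)) (ν := volume)).measure_preimage_emb
    MeasurableEquiv.prodComm.measurableEmbedding S

lemma volume_strip_snd_le {C : Set (ℝ × ℝ)} {a b : ℝ} (hC : Convex ℝ C) (hclosed : IsClosed C)
    (hsub : C ⊆ centeredRect a b) (hvol : volume (centeredRect a b) ≤ 2 * volume C)
    {J : Set ℝ} (hJ : MeasurableSet J) (hJs : ∀ s ∈ J, ∀ t, |t| ≤ |s| → t ∈ J) :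
    volume (centeredRect a b ∩ Prod.snd ⁻¹' J) ≤ 2 * volume (C ∩ Prod.snd ⁻¹' J) := by
  have hC' : Convex ℝ (Prod.swap ⁻¹' C) :=
    hC.is_linear_preimage (f := Prod.swap) ⟨fun _ _ => rfl, fun _ _ => rfl⟩
  have h := volume_strip_le (C := Prod.swap ⁻¹' C) (a := b) (b := a) hC'
    (hclosed.preimage continuous_swap)
    (by rw [← swap_preimage_centeredRect]; exact preimage_mono hsub)
    (by rwa [← swap_preimage_centeredRect, volume_swap_preimage, volume_swap_preimage]) hJ hJs
  have e : (Prod.fst ⁻¹' J : Set (ℝ × ℝ)) = Prod.swap ⁻¹' (Prod.snd ⁻¹' J) := rfl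
  rwa [e, ← swap_preimage_centeredRect, ← preimage_inter, ← preimage_inter,
    volume_swap_preimage, volume_swap_preimage] at h

/-- The comparison for functions of the second coordinate decreasing away from the center. -/
lemma lintegral_snd_le {C : Set (ℝ × ℝ)} {a b : ℝ} (hC : Convex ℝ C) (hclosed : IsClosed C)
    (hsub : C ⊆ centeredRect a b) (hvol : volume (centeredRect a b) ≤ 2 * volume C)
    {G : ℝ → ℝ} (hG : Measurable G) (hG0 : ∀ y, 0 ≤ G y)
    (hGs : ∀ s t, |t| ≤ |s| → G s ≤ G t) :
    ∫⁻ z in centeredRect a b, ENNReal.ofReal (G z.2) ≤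
      2 * ∫⁻ z in C, ENNReal.ofReal (G z.2) := by
  have hm : Measurable fun z : ℝ × ℝ => G z.2 := hG.comp measurable_snd
  have hset : ∀ (S : Set (ℝ × ℝ)) (t : ℝ), (volume.restrict S) {z : ℝ × ℝ | t < G z.2} =
      volume (S ∩ Prod.snd ⁻¹' {y | t < G y}) := by
    intro S t
    rw [Measure.restrict_apply (measurableSet_lt measurable_const hm), inter_comm]
    rfl
  rw [lintegral_eq_lintegral_meas_lt (f := fun z : ℝ × ℝ => G z.2) _
      (.of_forall fun z => hG0 z.2) hm.aemeasurable,
    lintegral_eq_lintegral_meas_lt (f := fun z : ℝ × ℝ => G z.2) _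
      (.of_forall fun z => hG0 z.2) hm.aemeasurable,
    ← lintegral_const_mul' _ _ (by simp)]
  refine lintegral_mono fun t => ?_
  rw [hset, hset]
  exact volume_strip_snd_le hC hclosed hsub hvol (measurableSet_lt measurable_const hG)
    fun s hs u hu => lt_of_lt_of_le hs (hGs s u hu)

lemma antitone_div_sqrt {s : ℝ} (hs : 0 < s) {y y' : ℝ} (h : |y'| ≤ |y|) :
    s / √(s ^ 2 + y ^ 2) ≤ s / √(s ^ 2 + y' ^ 2) := by
  have := sq_le_sq.2 h
  gcongr

lemma hasDerivAt_sqrt_sq_add {x c : ℝ} (hx : x ≠ 0) :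
    HasDerivAt (fun x => √(x ^ 2 + c ^ 2)) (x / √(x ^ 2 + c ^ 2)) x := by
  have h0 : x ^ 2 + c ^ 2 ≠ 0 := by positivity
  refine (((hasDerivAt_pow 2 x).add_const (c ^ 2)).sqrt h0).congr_deriv ?_
  norm_num [mul_div_mul_left]

lemma sqrt_sub_sqrt_eq_integral {a x : ℝ} (hx : |x| ≤ a) (y : ℝ) :
    IntervalIntegrable (fun s => s / √(s ^ 2 + y ^ 2)) volume |x| a ∧
    ∫ s in |x|..a, s / √(s ^ 2 + y ^ 2) = √(a ^ 2 + y ^ 2) - √(x ^ 2 + y ^ 2) := by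
  have hder : ∀ s ∈ Ioo |x| a,
      HasDerivAt (fun s => √(s ^ 2 + y ^ 2)) (s / √(s ^ 2 + y ^ 2)) s :=
    fun s hs => hasDerivAt_sqrt_sq_add ((abs_nonneg x).trans_lt hs.1).ne'
  have hcont : ContinuousOn (fun s : ℝ => √(s ^ 2 + y ^ 2)) (Icc |x| a) := by fun_prop
  have hint : IntervalIntegrable (fun s => s / √(s ^ 2 + y ^ 2)) volume |x| a := by
    rw [intervalIntegrable_iff_integrableOn_Ioc_of_le hx]
    exact intervalIntegral.integrableOn_deriv_of_nonneg hcont hder fun s hs =>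
      div_nonneg ((abs_nonneg x).trans hs.1.le) (sqrt_nonneg _)
  refine ⟨hint, ?_⟩
  rw [intervalIntegral.integral_eq_sub_of_hasDerivAt_of_le hx hcont hder hint, sq_abs]

/-- Decomposition of the gap between the distance to a corner and the distance to a point. -/
lemma ofReal_gap_eq {a b x y : ℝ} (hx : |x| ≤ a) (hy : |y| ≤ b) :
    ENNReal.ofReal (√(a ^ 2 + b ^ 2) - √(x ^ 2 + y ^ 2)) =
      ENNReal.ofReal (max 0 (√(a ^ 2 + b ^ 2) - √(a ^ 2 + y ^ 2))) +
      ∫⁻ s in Ioc 0 a, (Icc (-s) s).indicator (fun _ => ENNReal.ofReal (s / √(s ^ 2 + y ^ 2))) x := by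
  obtain ⟨hint, hval⟩ := sqrt_sub_sqrt_eq_integral hx y
  have hb : √(a ^ 2 + y ^ 2) ≤ √(a ^ 2 + b ^ 2) :=
    sqrt_le_sqrt (by linarith [sq_le_sq' (abs_le.1 hy).1 (abs_le.1 hy).2])
  have ha : √(x ^ 2 + y ^ 2) ≤ √(a ^ 2 + y ^ 2) :=
    sqrt_le_sqrt (by linarith [sq_le_sq' (abs_le.1 hx).1 (abs_le.1 hx).2])
  have hI : ∫⁻ s in Ioc 0 a,
      (Icc (-s) s).indicator (fun _ => ENNReal.ofReal (s / √(s ^ 2 + y ^ 2))) x =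
      ENNReal.ofReal (√(a ^ 2 + y ^ 2) - √(x ^ 2 + y ^ 2)) := by
    rw [intervalIntegral.integral_of_le hx] at hval
    rw [intervalIntegrable_iff_integrableOn_Ioc_of_le hx] at hint
    rw [← hval, ofReal_integral_eq_lintegral_ofReal hint
      ((ae_restrict_mem measurableSet_Ioc).mono fun s hs =>
        div_nonneg ((abs_nonneg x).trans hs.1.le) (sqrt_nonneg _)),
      setLIntegral_congr Ioc_ae_eq_Icc, ← lintegral_indicator measurableSet_Icc,
      setLIntegral_congr Ioc_ae_eq_Icc, ← lintegral_indicator measurableSet_Icc]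
    congr with s
    have hiff : (s ∈ Icc 0 a ∧ x ∈ Icc (-s) s) ↔ s ∈ Icc |x| a := by
      simp only [mem_Icc, abs_le.symm]
      exact ⟨fun h => ⟨h.2, h.1.2⟩, fun h => ⟨⟨(abs_nonneg x).trans h.1, h.2⟩, h.1⟩⟩
    simp only [indicator_apply, ← ite_and, hiff]
  rw [hI, max_eq_right (by linarith), ← ENNReal.ofReal_add (by linarith) (by linarith)]
  congr 1
  ring

/-- The decomposition of `ofReal_gap_eq`, integrated over a subset of the rectangle. -/
lemma lintegral_gap_eq {S : Set (ℝ × ℝ)} {a b : ℝ} (hS : MeasurableSet S)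
    (hsub : S ⊆ centeredRect a b) :
    ∫⁻ z in S, ENNReal.ofReal (√(a ^ 2 + b ^ 2) - √(z.1 ^ 2 + z.2 ^ 2)) =
      (∫⁻ z in S, ENNReal.ofReal (max 0 (√(a ^ 2 + b ^ 2) - √(a ^ 2 + z.2 ^ 2)))) +
      ∫⁻ s in Ioc 0 a, ∫⁻ z in S ∩ Prod.fst ⁻¹' Icc (-s) s,
        ENNReal.ofReal (s / √(s ^ 2 + z.2 ^ 2)) := by
  have e1 : ∫⁻ z in S, ENNReal.ofReal (√(a ^ 2 + b ^ 2) - √(z.1 ^ 2 + z.2 ^ 2)) =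
      ∫⁻ z in S, (ENNReal.ofReal (max 0 (√(a ^ 2 + b ^ 2) - √(a ^ 2 + z.2 ^ 2))) +
      ∫⁻ s in Ioc 0 a, (Icc (-s) s).indicator
        (fun _ => ENNReal.ofReal (s / √(s ^ 2 + z.2 ^ 2))) z.1) :=
    setLIntegral_congr_fun hS fun z hz =>
      ofReal_gap_eq (abs_le.2 (hsub hz).1) (abs_le.2 (hsub hz).2)
  rw [e1, lintegral_add_left (by fun_prop)]
  congr 1
  rw [lintegral_lintegral_swap]
  · refine lintegral_congr fun s => ?_
    have hm : MeasurableSet (Prod.fst ⁻¹' Icc (-s) s : Set (ℝ × ℝ)) :=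
      measurable_fst measurableSet_Icc
    rw [inter_comm, ← Measure.restrict_restrict hm, ← lintegral_indicator hm]
    rfl
  · have hms : MeasurableSet {p : (ℝ × ℝ) × ℝ | p.1.1 ∈ Icc (-p.2) p.2} := by
      have e : {p : (ℝ × ℝ) × ℝ | p.1.1 ∈ Icc (-p.2) p.2} =
          {p | -p.2 ≤ p.1.1} ∩ {p | p.1.1 ≤ p.2} := rfl
      rw [e]
      exact (measurableSet_le (by fun_prop) (by fun_prop)).inter
        (measurableSet_le (by fun_prop) (by fun_prop))
    have hmf : Measurable fun p : (ℝ × ℝ) × ℝ =>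
        ENNReal.ofReal (p.2 / √(p.2 ^ 2 + p.1.2 ^ 2)) := by fun_prop
    exact (hmf.indicator hms).aemeasurable

lemma lintegral_gap_le {C : Set (ℝ × ℝ)} {a b : ℝ} (hC : Convex ℝ C) (hclosed : IsClosed C)
    (hsub : C ⊆ centeredRect a b) (hvol : volume (centeredRect a b) ≤ 2 * volume C) :
    ∫⁻ z in centeredRect a b, ENNReal.ofReal (√(a ^ 2 + b ^ 2) - √(z.1 ^ 2 + z.2 ^ 2)) ≤
      2 * ∫⁻ z in C, ENNReal.ofReal (√(a ^ 2 + b ^ 2) - √(z.1 ^ 2 + z.2 ^ 2)) := by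
  rw [lintegral_gap_eq (isCompact_centeredRect a b).measurableSet subset_rfl,
    lintegral_gap_eq hclosed.measurableSet hsub, mul_add]
  refine add_le_add ?_ ?_
  · refine lintegral_snd_le hC hclosed hsub hvol
      (G := fun y => max 0 (√(a ^ 2 + b ^ 2) - √(a ^ 2 + y ^ 2))) (by fun_prop)
      (fun y => le_max_left _ _) fun s t hst => ?_
    have := sq_le_sq.2 hst
    gcongr
  · rw [← lintegral_const_mul' _ _ (by simp)]
    refine setLIntegral_mono' measurableSet_Ioc fun s hs => ?_
    have hrect : centeredRect a b ∩ Prod.fst ⁻¹' Icc (-s) s = centeredRect s b := by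
      ext ⟨x, y⟩
      simp only [centeredRect, mem_inter_iff, mem_prod, mem_preimage, mem_Icc]
      constructor
      · tauto
      · rintro ⟨h1, h2⟩
        exact ⟨⟨⟨by linarith [hs.2], by linarith [hs.2]⟩, h2⟩, h1⟩
    have hstrip := volume_strip_le hC hclosed hsub hvol (J := Icc (-s) s) measurableSet_Icc
      fun u hu t ht => abs_le.1 (ht.trans (abs_le.2 hu))
    rw [hrect] at hstrip ⊢
    refine lintegral_snd_le (hC.inter ((convex_Icc _ _).is_linear_preimage
        (f := Prod.fst) ⟨fun _ _ => rfl, fun _ _ => rfl⟩))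
      (hclosed.inter (isClosed_Icc.preimage continuous_fst))
      (hrect ▸ inter_subset_inter_left _ hsub) hstrip
      (G := fun y => s / √(s ^ 2 + y ^ 2)) (by fun_prop)
      (fun y => div_nonneg hs.1.le (sqrt_nonneg _)) fun y y' h => antitone_div_sqrt hs.1 h

lemma setIntegral_sqrt_le {C : Set (ℝ × ℝ)} {a b : ℝ} (hC : Convex ℝ C) (hclosed : IsClosed C)
    (hsub : C ⊆ centeredRect a b) (hvol : volume (centeredRect a b) = 2 * volume C) :
    ∫ z in C, √(z.1 ^ 2 + z.2 ^ 2) ≤ 1 / 2 * ∫ z in centeredRect a b, √(z.1 ^ 2 + z.2 ^ 2) := by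
  set K := √(a ^ 2 + b ^ 2) with hK
  have hfin : volume (centeredRect a b) ≠ ∞ := (isCompact_centeredRect a b).measure_lt_top.ne
  have hcont : Continuous fun z : ℝ × ℝ => √(z.1 ^ 2 + z.2 ^ 2) := by fun_prop
  have hint : IntegrableOn (fun z : ℝ × ℝ => √(z.1 ^ 2 + z.2 ^ 2)) (centeredRect a b) :=
    hcont.continuousOn.integrableOn_compact (isCompact_centeredRect a b)
  have hconst : IntegrableOn (fun _ : ℝ × ℝ => K) (centeredRect a b) :=
    integrableOn_const hfin
  have hnn : ∀ z ∈ centeredRect a b, 0 ≤ K - √(z.1 ^ 2 + z.2 ^ 2) := fun z hz => by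
    have h1 := sq_le_sq' hz.1.1 hz.1.2
    have h2 := sq_le_sq' hz.2.1 hz.2.2
    rw [hK, sub_nonneg]
    gcongr
  have hval : ∀ S : Set (ℝ × ℝ), MeasurableSet S → S ⊆ centeredRect a b →
      ∫⁻ z in S, ENNReal.ofReal (K - √(z.1 ^ 2 + z.2 ^ 2)) =
        ENNReal.ofReal (volume.real S * K - ∫ z in S, √(z.1 ^ 2 + z.2 ^ 2)) ∧
      0 ≤ volume.real S * K - ∫ z in S, √(z.1 ^ 2 + z.2 ^ 2) := by
    intro S hS hSs
    have hi := (hconst.mono_set hSs).sub (hint.mono_set hSs)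
    have e : ∫ z in S, (K - √(z.1 ^ 2 + z.2 ^ 2)) =
        volume.real S * K - ∫ z in S, √(z.1 ^ 2 + z.2 ^ 2) := by
      rw [integral_sub (hconst.mono_set hSs) (hint.mono_set hSs), setIntegral_const, smul_eq_mul]
    rw [← e]
    refine ⟨(ofReal_integral_eq_lintegral_ofReal hi
      ((ae_restrict_mem hS).mono fun z hz => hnn z (hSs hz))).symm,
      setIntegral_nonneg hS fun z hz => hnn z (hSs hz)⟩
  have hmain := lintegral_gap_le hC hclosed hsub hvol.le
  obtain ⟨h1, -⟩ := hval _ (isCompact_centeredRect a b).measurableSet subset_rfl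
  obtain ⟨h2, h2'⟩ := hval _ hclosed.measurableSet hsub
  rw [h1, h2, show (2 : ℝ≥0∞) = ENNReal.ofReal 2 by simp,
    ← ENNReal.ofReal_mul (by norm_num), ENNReal.ofReal_le_ofReal_iff (by positivity)] at hmain
  have hv : volume.real (centeredRect a b) = 2 * volume.real C := by
    simp [Measure.real, hvol]
  rw [hv] at hmain
  linarith

lemma integral_neg_self_eq_two_mul {f : ℝ → ℝ} (hf : Continuous f) (heven : ∀ x, f (-x) = f x)
    (a : ℝ) : ∫ x in -a..a, f x = 2 * ∫ x in 0..a, f x := by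
  have h : ∫ x in -a..0, f x = ∫ x in 0..a, f x := by
    simpa [heven] using (intervalIntegral.integral_comp_neg (a := 0) (b := a) f).symm
  rw [← intervalIntegral.integral_add_adjacent_intervals (hf.intervalIntegrable (-a) 0)
    (hf.intervalIntegrable 0 a), h, two_mul]

lemma integral_sqrt_sq_add_sq {x b : ℝ} (hx : 0 < x) (hb : 0 ≤ b) :
    ∫ y in 0..b, √(x ^ 2 + y ^ 2) =
      (b * √(x ^ 2 + b ^ 2) + x ^ 2 * log (b + √(x ^ 2 + b ^ 2)) - x ^ 2 * log x) / 2 := by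
  have hpos : ∀ y : ℝ, 0 < √(x ^ 2 + y ^ 2) := fun y => by positivity
  have hlog : ∀ y ∈ Icc 0 b, y + √(x ^ 2 + y ^ 2) ≠ 0 := fun y hy => by
    have := hpos y
    have := hy.1
    positivity
  rw [intervalIntegral.integral_eq_sub_of_hasDerivAt_of_le
    (f := fun y => (y * √(x ^ 2 + y ^ 2) + x ^ 2 * log (y + √(x ^ 2 + y ^ 2))) / 2) hb]
  · simp [sqrt_sq hx.le]
    ring
  · have : ContinuousOn (fun y => log (y + √(x ^ 2 + y ^ 2))) (Icc 0 b) :=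
      ContinuousOn.log (by fun_prop) hlog
    fun_prop
  · intro y hy
    have hr : HasDerivAt (fun y => √(x ^ 2 + y ^ 2)) (y / √(x ^ 2 + y ^ 2)) y := by
      simpa only [add_comm] using hasDerivAt_sqrt_sq_add (c := x) hy.1.ne'
    have hl := ((hasDerivAt_id' y).add hr).log (hlog y (Ioo_subset_Icc_self hy))
    have h := (((hasDerivAt_id' y).mul hr).add (hl.const_mul (x ^ 2))).div_const 2
    refine h.congr_deriv ?_
    have h1 := hpos y
    have h2 := hlog y (Ioo_subset_Icc_self hy)
    have h3 : √(x ^ 2 + y ^ 2) ^ 2 = x ^ 2 + y ^ 2 := sq_sqrt (by positivity)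
    simp only [Pi.add_apply]
    set r := √(x ^ 2 + y ^ 2)
    field_simp
    linear_combination -(r + y) * h3
  · exact Continuous.intervalIntegrable (by fun_prop) _ _

lemma integral_integral_sqrt {a b : ℝ} (ha : 0 < a) (hb : 0 < b) :
    ∫ x in 0..a, ∫ y in 0..b, √(x ^ 2 + y ^ 2) =
      a * b * √(a ^ 2 + b ^ 2) / 3 + a ^ 3 / 6 * log ((√(a ^ 2 + b ^ 2) + b) / a) +
        b ^ 3 / 6 * log ((√(a ^ 2 + b ^ 2) + a) / b) := by
  have hpos : ∀ x : ℝ, 0 < √(x ^ 2 + b ^ 2) := fun x => by positivity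
  have hlog1 : ∀ x ∈ Icc 0 a, x + √(x ^ 2 + b ^ 2) ≠ 0 := fun x hx => by
    have := hpos x
    have := hx.1
    positivity
  have hlog2 : ∀ x : ℝ, b + √(x ^ 2 + b ^ 2) ≠ 0 := fun x => by
    have := hpos x
    positivity
  have hcl1 : ContinuousOn (fun x => log (x + √(x ^ 2 + b ^ 2))) (Icc 0 a) :=
    ContinuousOn.log (by fun_prop) hlog1
  have hcl2 : Continuous (fun x => log (b + √(x ^ 2 + b ^ 2))) :=
    Continuous.log (by fun_prop) hlog2
  have hcl3 : Continuous fun x : ℝ => x * log x := continuous_mul_log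
  have hinner : Continuous fun x : ℝ => ∫ y in 0..b, √(x ^ 2 + y ^ 2) :=
    intervalIntegral.continuous_parametric_intervalIntegral_of_continuous'
      (f := fun x y => √(x ^ 2 + y ^ 2)) (by fun_prop) _ _
  rw [intervalIntegral.integral_eq_sub_of_hasDerivAt_of_le
    (f := fun x => x * b * √(x ^ 2 + b ^ 2) / 3 + b ^ 3 / 6 * log (x + √(x ^ 2 + b ^ 2)) +
      x ^ 3 / 6 * log (b + √(x ^ 2 + b ^ 2)) - x ^ 2 / 6 * (x * log x)) ha.le]
  · have h1 : 0 < √(a ^ 2 + b ^ 2) := hpos a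
    rw [log_div (by positivity) ha.ne', log_div (by positivity) hb.ne']
    simp [sqrt_sq hb.le, add_comm]
    ring
  · fun_prop
  · intro x hx
    rw [integral_sqrt_sq_add_sq hx.1 hb.le]
    have hr := hasDerivAt_sqrt_sq_add (c := b) hx.1.ne'
    have hl1 := ((hasDerivAt_id' x).add hr).log (hlog1 x (Ioo_subset_Icc_self hx))
    have hl2 := (hr.const_add b).log (hlog2 x)
    have hl3 := hasDerivAt_mul_log hx.1.ne'
    have h := (((((((hasDerivAt_id' x).mul_const b).mul hr).div_const 3).add
      (hl1.const_mul (b ^ 3 / 6))).add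
      (((hasDerivAt_pow 3 x).div_const 6).mul hl2)).sub
      (((hasDerivAt_pow 2 x).div_const 6).mul hl3))
    refine h.congr_deriv ?_
    have h1 := hpos x
    have h2 := hlog1 x (Ioo_subset_Icc_self hx)
    have h3 := hlog2 x
    have h4 : √(x ^ 2 + b ^ 2) ^ 2 = x ^ 2 + b ^ 2 := sq_sqrt (by positivity)
    simp only [Pi.add_apply]
    set r := √(x ^ 2 + b ^ 2)
    have e1 : (1 + x / r) / (x + r) = 1 / r := by field_simp; ring
    have e2 : x ^ 3 / 6 * ((x / r) / (b + r)) = x ^ 2 / 6 * ((r - b) / r) := by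
      field_simp
      linear_combination -x ^ 2 * h4
    rw [e1, e2]
    field_simp
    push_cast
    linear_combination -6 * b * h4
  · exact hinner.intervalIntegrable _ _

lemma setIntegral_centeredRect_sqrt {a b : ℝ} (ha : 0 < a) (hb : 0 < b) :
    ∫ z in centeredRect a b, √(z.1 ^ 2 + z.2 ^ 2) = FWrect (2 * a) (2 * b) := by
  have hcont : Continuous fun z : ℝ × ℝ => √(z.1 ^ 2 + z.2 ^ 2) := by fun_prop
  have hinner : Continuous fun x : ℝ => ∫ y in 0..b, √(x ^ 2 + y ^ 2) :=
    intervalIntegral.continuous_parametric_intervalIntegral_of_continuous'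
      (f := fun x y => √(x ^ 2 + y ^ 2)) (by fun_prop) _ _
  have e : ∀ x : ℝ, ∫ y in Icc (-b) b, √(x ^ 2 + y ^ 2) = 2 * ∫ y in 0..b, √(x ^ 2 + y ^ 2) := by
    intro x
    rw [integral_Icc_eq_integral_Ioc, ← intervalIntegral.integral_of_le (by linarith),
      integral_neg_self_eq_two_mul (by fun_prop) (by simp)]
  rw [centeredRect, Measure.volume_eq_prod, setIntegral_prod _
    (hcont.continuousOn.integrableOn_compact (isCompact_centeredRect a b))]
  simp only [e]
  rw [integral_Icc_eq_integral_Ioc, ← intervalIntegral.integral_of_le (by linarith),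
    intervalIntegral.integral_const_mul, integral_neg_self_eq_two_mul hinner (by simp),
    integral_integral_sqrt ha hb, FWrect]
  have hs : √((2 * b) ^ 2 + (2 * a) ^ 2) = 2 * √(a ^ 2 + b ^ 2) := by
    rw [show (2 * b) ^ 2 + (2 * a) ^ 2 = 2 ^ 2 * (a ^ 2 + b ^ 2) by ring,
      sqrt_mul (by norm_num), sqrt_sq (by norm_num)]
  rw [hs, ← mul_add, ← mul_add, mul_div_mul_left _ _ two_ne_zero, mul_div_mul_left _ _ two_ne_zero]
  ring

/-- The comparison with half of the rectangle, for convex sets that need not be closed. -/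
lemma setIntegral_sqrt_le_of_convex {C : Set (ℝ × ℝ)} {a b : ℝ} (hC : Convex ℝ C)
    (hsub : C ⊆ centeredRect a b) (hvol : volume (centeredRect a b) = 2 * volume C) :
    ∫ z in C, √(z.1 ^ 2 + z.2 ^ 2) ≤ 1 / 2 * ∫ z in centeredRect a b, √(z.1 ^ 2 + z.2 ^ 2) := by
  have hae : closure C =ᵐ[volume] C := closure_ae_eq_of_null_frontier (hC.addHaar_frontier volume)
  rw [← setIntegral_congr_set hae]
  exact setIntegral_sqrt_le hC.closure isClosed_closure
    (closure_minimal hsub (isCompact_centeredRect a b).isClosed) (by rwa [measure_congr hae])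

lemma measurePreserving_add_toLp (x₀ : EuclideanSpace ℝ (Fin 2)) :
    MeasurePreserving (fun z : ℝ × ℝ => x₀ + !₂[z.1, z.2]) :=
  (measurePreserving_add_left volume x₀).comp
    ((PiLp.volume_preserving_toLp (Fin 2)).comp (volume_preserving_finTwoArrow ℝ).symm)

lemma measurableEmbedding_add_toLp (x₀ : EuclideanSpace ℝ (Fin 2)) :
    MeasurableEmbedding (fun z : ℝ × ℝ => x₀ + !₂[z.1, z.2]) :=
  (measurableEmbedding_addLeft x₀).comp
    ((MeasurableEquiv.toLp 2 (Fin 2 → ℝ)).measurableEmbedding.comp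
      (MeasurableEquiv.finTwoArrow (α := ℝ)).symm.measurableEmbedding)

theorem fermat_weber_half_area_upper_bound (w h : ℝ) (hw : 0 < w) (hh : 0 < h)
    (C : Set (EuclideanSpace ℝ (Fin 2))) (hconv : Convex ℝ C)
    (hsub : C ⊆ {x : EuclideanSpace ℝ (Fin 2) |
      x 0 ∈ Set.Icc 0 w ∧ x 1 ∈ Set.Icc 0 h})
    (harea : (volume C).toReal = w * h / 2)
    (x₀ : EuclideanSpace ℝ (Fin 2)) (hx₀0 : x₀ 0 = w / 2) (hx₀1 : x₀ 1 = h / 2) :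
    ∫ x in C, ‖x - x₀‖ ∂volume ≤ 1 / 2 * FWrect w h := by
  have hmp := measurePreserving_add_toLp x₀
  have hme := measurableEmbedding_add_toLp x₀
  set φ : ℝ × ℝ → EuclideanSpace ℝ (Fin 2) := fun z => x₀ + !₂[z.1, z.2] with hφ
  have hconv' : Convex ℝ (φ ⁻¹' C) := by
    intro z hz z' hz' α β hα hβ hαβ
    have := hconv hz hz' hα hβ hαβ
    rw [mem_preimage]
    convert this using 1
    ext i
    fin_cases i <;> simp [hφ] <;> linear_combination (-1) * hαβ * x₀ _
  have hsub' : φ ⁻¹' C ⊆ centeredRect (w / 2) (h / 2) := by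
    intro z hz
    obtain ⟨⟨h1, h2⟩, h3, h4⟩ := hsub hz
    simp only [hφ, PiLp.add_apply, hx₀0, hx₀1] at h1 h2 h3 h4
    simp at h1 h2 h3 h4
    exact ⟨⟨by linarith, by linarith⟩, by linarith, by linarith⟩
  have hvol : volume (centeredRect (w / 2) (h / 2)) = 2 * volume (φ ⁻¹' C) := by
    have hne : volume C ≠ ∞ := by
      intro htop
      rw [htop, ENNReal.toReal_top] at harea
      have : 0 < w * h := by positivity
      linarith
    rw [hmp.measure_preimage_emb hme, ← ENNReal.ofReal_toReal hne, harea, centeredRect,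
      Measure.volume_eq_prod, Measure.prod_prod, Real.volume_Icc, Real.volume_Icc,
      ← ENNReal.ofReal_mul (by linarith), show (2 : ℝ≥0∞) = ENNReal.ofReal 2 by simp,
      ← ENNReal.ofReal_mul (by norm_num)]
    congr 1
    ring
  have hint : ∫ x in C, ‖x - x₀‖ = ∫ z in φ ⁻¹' C, √(z.1 ^ 2 + z.2 ^ 2) := by
    rw [← hmp.setIntegral_preimage_emb hme]
    simp [hφ, EuclideanSpace.norm_eq, Fin.sum_univ_two]
  rw [hint]
  refine (setIntegral_sqrt_le_of_convex hconv' hsub' hvol).trans (le_of_eq ?_)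
  rw [setIntegral_centeredRect_sqrt (by positivity) (by positivity),
    mul_div_cancel₀ _ two_ne_zero, mul_div_cancel₀ _ two_ne_zero]
end

section
/- Let w ≥ h > 0 and let C be a convex subset of the axis-aligned rectangle [0,w] × [0,h] in the Euclidean plane with Lebesgue area A > 0. Assume that C contains a horizontal line segment whose length equals the width of C (the length of the projection of C onto the x-axis). Then there exists a point p ∈ ℝ² such that ∫_C ‖x − p‖ dx ≤ (1/2)·FW_rect(w, 2A/w), where FW_rect(w,h') = (1/6)·h'·w·√(h'² + w²) + (1/12)·w³·log((√(h'² + w²) + h')/w) + (1/12)·h'³·log((√(h'² + w²) + w)/h'). -/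
open MeasureTheory Real

open scoped Pointwise

/-- A compact convex set inscribed in the box `[-m, m] × [-n, n]`: it is contained in the box and
touches all four of its sides. -/
structure InscribedInBox (D : Set (ℝ × ℝ)) (m n : ℝ) : Prop where
  isCompact : IsCompact D
  convex : Convex ℝ D
  abs_fst_le : ∀ z ∈ D, |z.1| ≤ m
  abs_snd_le : ∀ z ∈ D, |z.2| ≤ n
  left : ∃ y, (-m, y) ∈ D
  right : ∃ y, (m, y) ∈ D
  bottom : ∃ x, (x, -n) ∈ D
  top : ∃ x, (x, n) ∈ D

namespace InscribedInBox

variable {D : Set (ℝ × ℝ)} {m n : ℝ}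

lemma swap (hD : InscribedInBox D m n) : InscribedInBox (Prod.swap ⁻¹' D) n m where
  isCompact := by
    have := hD.isCompact.image (continuous_swap (X := ℝ) (Y := ℝ))
    rwa [Set.image_swap_eq_preimage_swap] at this
  convex := hD.convex.is_linear_preimage ⟨fun _ _ => rfl, fun _ _ => rfl⟩
  abs_fst_le z hz := hD.abs_snd_le _ hz
  abs_snd_le z hz := hD.abs_fst_le _ hz
  left := hD.bottom
  right := hD.top
  bottom := hD.left
  top := hD.right

lemma zero_mem (hD : InscribedInBox D m n) : (0 : ℝ × ℝ) ∈ D := by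
  by_contra h0
  obtain ⟨f, u, hu, hf⟩ := geometric_hahn_banach_point_closed hD.convex hD.isCompact.isClosed h0
  rw [map_zero] at hu
  have hfz : ∀ x y : ℝ, f (x, y) = x * f (1, 0) + y * f (0, 1) := fun x y => by
    have : ((x, y) : ℝ × ℝ) = x • (1, 0) + y • (0, 1) := by simp
    rw [this, map_add, map_smul, map_smul, smul_eq_mul, smul_eq_mul]
  set p := f (1, 0)
  set q := f (0, 1)
  have bound : ∀ {a c t : ℝ}, |a| ≤ c → a * t ≤ c * |t| := fun {a c t} h =>
    (le_abs_self _).trans (by rw [abs_mul]; exact mul_le_mul_of_nonneg_right h (abs_nonneg t))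
  obtain ⟨yl, hl⟩ := hD.left
  obtain ⟨yr, hr⟩ := hD.right
  obtain ⟨xb, hb⟩ := hD.bottom
  obtain ⟨xt, ht⟩ := hD.top
  have el := hf _ hl
  have er := hf _ hr
  have eb := hf _ hb
  have et := hf _ ht
  rw [hfz] at el er eb et
  have bl := bound (t := q) (hD.abs_snd_le _ hl)
  have br := bound (t := q) (hD.abs_snd_le _ hr)
  have bb := bound (t := p) (hD.abs_fst_le _ hb)
  have bt := bound (t := p) (hD.abs_fst_le _ ht)
  simp only at bl br bb bt
  rcases abs_cases p with ⟨h1, -⟩ | ⟨h1, -⟩ <;> rcases abs_cases q with ⟨h2, -⟩ | ⟨h2, -⟩ <;>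
    rw [h1] at bb bt <;> rw [h2] at bl br <;> linarith

end InscribedInBox

/-- The one-dimensional Brunn-Minkowski inequality for compact intervals. -/
lemma volume_combo_le_of_isCompact {S T U : Set ℝ} (hS : IsCompact S) (hT : IsCompact T)
    (hS0 : S.Nonempty) (hT0 : T.Nonempty) (hU : Convex ℝ U) {α β : ℝ} (hα : 0 ≤ α) (hβ : 0 ≤ β)
    (h : ∀ s ∈ S, ∀ t ∈ T, α * s + β * t ∈ U) :
    ENNReal.ofReal α * volume S + ENNReal.ofReal β * volume T ≤ volume U := by
  have key : ∀ {R : Set ℝ}, IsCompact R → R.Nonempty →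
      volume R ≤ ENNReal.ofReal (sSup R - sInf R) ∧ sInf R ≤ sSup R := fun {R} hR h0 =>
    ⟨Real.volume_Icc ▸ measure_mono
      (fun x hx => ⟨csInf_le hR.bddBelow hx, le_csSup hR.bddAbove hx⟩),
      csInf_le_csSup h0 hR.bddBelow hR.bddAbove⟩
  have hl := h _ (hS.sInf_mem hS0) _ (hT.sInf_mem hT0)
  have hu := h _ (hS.sSup_mem hS0) _ (hT.sSup_mem hT0)
  obtain ⟨vS, oS⟩ := key hS hS0
  obtain ⟨vT, oT⟩ := key hT hT0
  calc _ ≤ ENNReal.ofReal α * ENNReal.ofReal (sSup S - sInf S)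
        + ENNReal.ofReal β * ENNReal.ofReal (sSup T - sInf T) := by gcongr
    _ = ENNReal.ofReal (α * (sSup S - sInf S) + β * (sSup T - sInf T)) := by
        rw [← ENNReal.ofReal_mul hα, ← ENNReal.ofReal_mul hβ, ← ENNReal.ofReal_add] <;>
          apply mul_nonneg <;> linarith
    _ = volume (Set.Icc (α * sInf S + β * sInf T) (α * sSup S + β * sSup T)) := by
        rw [Real.volume_Icc]; ring_nf
    _ ≤ volume U := measure_mono (hU.ordConnected.out hl hu)

lemma lintegral_eq_mul_lintegral_comp_mul {τ : ℝ} (hτ : 0 < τ) {F : ℝ → ENNReal}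
    (hF : Measurable F) :
    ∫⁻ x, F x = ENNReal.ofReal τ * ∫⁻ x, F (τ * x) := by
  have h := lintegral_map (μ := volume) hF (measurable_const_mul τ)
  rw [Real.map_volume_mul_left hτ.ne', lintegral_smul_measure] at h
  rw [← h, smul_eq_mul, ← mul_assoc, ← ENNReal.ofReal_mul hτ.le, abs_of_pos (inv_pos.2 hτ),
    mul_inv_cancel₀ hτ.ne', ENNReal.ofReal_one, one_mul]

namespace InscribedInBox

variable {D : Set (ℝ × ℝ)} {m n : ℝ}

lemma isCompact_slice (hD : InscribedInBox D m n) (x : ℝ) : IsCompact (Prod.mk x ⁻¹' D) :=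
  (hD.isCompact.image continuous_snd).of_isClosed_subset
    (hD.isCompact.isClosed.preimage (by fun_prop)) fun y hy => ⟨(x, y), hy, rfl⟩

lemma slice_nonempty (hD : InscribedInBox D m n) (hm : 0 < m) {x : ℝ} (hx : |x| ≤ m) :
    (Prod.mk x ⁻¹' D).Nonempty := by
  obtain ⟨yl, hl⟩ := hD.left
  obtain ⟨yr, hr⟩ := hD.right
  obtain ⟨h1, h2⟩ := abs_le.1 hx
  have := hD.convex hl hr (a := (m - x) / (2 * m)) (b := (m + x) / (2 * m))
    (div_nonneg (by linarith) (by linarith)) (div_nonneg (by linarith) (by linarith))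
    (by field_simp; ring)
  refine ⟨(m - x) / (2 * m) * yl + (m + x) / (2 * m) * yr, ?_⟩
  rw [Set.mem_preimage]
  convert this using 1
  ext
  · simp; field_simp; ring
  · simp

lemma strip (hD : InscribedInBox D m n) (hm : 0 < m) {τ : ℝ} (h0 : 0 ≤ τ) (h1 : τ ≤ 1) :
    ENNReal.ofReal τ * volume D ≤ volume (D ∩ {z | |z.1| ≤ τ * m}) := by
  rcases h0.eq_or_lt with rfl | hτ
  · simp
  set S := D ∩ {z : ℝ × ℝ | |z.1| ≤ τ * m} with hS
  have mD := hD.isCompact.measurableSet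
  have mS : MeasurableSet S := mD.inter (measurableSet_le (by fun_prop) measurable_const)
  have gD : Measurable fun x => volume (Prod.mk x ⁻¹' D) := measurable_measure_prodMk_left mD
  have gS : Measurable fun x => volume (Prod.mk x ⁻¹' S) := measurable_measure_prodMk_left mS
  have cslice := hD.isCompact_slice
  have pt : ∀ x : ℝ, ENNReal.ofReal ((1 + τ) / 2) * volume (Prod.mk x ⁻¹' D)
      + ENNReal.ofReal ((1 - τ) / 2) * volume (Prod.mk (-x) ⁻¹' D)
      ≤ volume (Prod.mk (τ * x) ⁻¹' S) := by
    intro x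
    by_cases hx : |x| ≤ m
    · have hx' : |τ * x| ≤ τ * m := by
        rw [abs_mul, abs_of_pos hτ]; gcongr
      have e : Prod.mk (τ * x) ⁻¹' S = Prod.mk (τ * x) ⁻¹' D := by
        ext y; simp only [hS, Set.mem_preimage, Set.mem_inter_iff, Set.mem_ofPred_eq, hx', and_true]
      rw [e]
      refine volume_combo_le_of_isCompact (cslice _) (cslice _) (hD.slice_nonempty hm hx)
        (hD.slice_nonempty hm (by rwa [abs_neg])) ?_ (by linarith) (by linarith) ?_
      · intro y hy z hz a b ha hb hab
        have := hD.convex hy hz ha hb hab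
        rw [Set.mem_preimage]
        convert this using 1
        ext
        · simp [← add_mul, hab]
        · simp
      · intro y hy z hz
        have := hD.convex hy hz (a := (1 + τ) / 2) (b := (1 - τ) / 2) (by linarith) (by linarith)
          (by ring)
        rw [Set.mem_preimage]
        convert this using 1
        ext
        · simp; ring
        · simp
    · have e : ∀ t : ℝ, |t| = |x| → Prod.mk t ⁻¹' D = ∅ := fun t ht =>
        Set.eq_empty_of_forall_notMem fun y hy => hx (ht ▸ hD.abs_fst_le _ hy)
      rw [e x rfl, e (-x) (abs_neg x)]
      simp
  have hrefl : ∫⁻ x, volume (Prod.mk (-x) ⁻¹' D) = ∫⁻ x, volume (Prod.mk x ⁻¹' D) :=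
    lintegral_neg_eq_self (fun x => volume (Prod.mk x ⁻¹' D))
  rw [Measure.volume_eq_prod, Measure.prod_apply mD, Measure.prod_apply mS,
    lintegral_eq_mul_lintegral_comp_mul hτ gS]
  refine mul_le_mul_right ?_ _
  calc ∫⁻ x, volume (Prod.mk x ⁻¹' D)
      = ENNReal.ofReal ((1 + τ) / 2) * (∫⁻ x, volume (Prod.mk x ⁻¹' D))
        + ENNReal.ofReal ((1 - τ) / 2) * (∫⁻ x, volume (Prod.mk (-x) ⁻¹' D)) := by
        have e : (1 + τ) / 2 + (1 - τ) / 2 = 1 := by ring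
        rw [hrefl, ← add_mul, ← ENNReal.ofReal_add (by linarith) (by linarith),
          e, ENNReal.ofReal_one, one_mul]
    _ = ∫⁻ x, (ENNReal.ofReal ((1 + τ) / 2) * volume (Prod.mk x ⁻¹' D)
      + ENNReal.ofReal ((1 - τ) / 2) * volume (Prod.mk (-x) ⁻¹' D)) := by
        rw [lintegral_add_left (gD.const_mul _), lintegral_const_mul _ gD,
          lintegral_const_mul (f := fun x => volume (Prod.mk (-x) ⁻¹' D)) _
            (gD.comp measurable_neg)]
    _ ≤ _ := lintegral_mono pt

lemma box_aux (hD : InscribedInBox D m n) (hm : 0 < m) {ξ η : ℝ} (h0 : 0 ≤ ξ)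
    (h1 : ξ ≤ η) (h2 : η ≤ 1) :
    ENNReal.ofReal (ξ * η) * volume D ≤ volume (D ∩ {z | |z.1| ≤ ξ * m ∧ |z.2| ≤ η * n}) := by
  rcases (h0.trans h1).eq_or_lt with rfl | hη
  · simp
  have hs := hD.strip hm (τ := ξ / η) (by positivity) ((div_le_one hη).2 h1)
  calc ENNReal.ofReal (ξ * η) * volume D
      = ENNReal.ofReal (η ^ 2) * (ENNReal.ofReal (ξ / η) * volume D) := by
        rw [← mul_assoc, ← ENNReal.ofReal_mul (by positivity)]
        congr 2; field_simp
    _ ≤ ENNReal.ofReal (η ^ 2) * volume (D ∩ {z | |z.1| ≤ ξ / η * m}) := by gcongr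
    _ = volume (η • (D ∩ {z : ℝ × ℝ | |z.1| ≤ ξ / η * m})) := by
        rw [Measure.addHaar_smul]
        simp
    _ ≤ _ := by
        apply measure_mono
        rintro _ ⟨z, ⟨hz, hz1⟩, rfl⟩
        refine ⟨hD.convex.smul_mem_of_zero_mem hD.zero_mem hz ⟨hη.le, h2⟩, ?_, ?_⟩
        · simp only [Prod.smul_fst, smul_eq_mul, abs_mul, abs_of_pos hη]
          calc η * |z.1| ≤ η * (ξ / η * m) := by gcongr; exact hz1
            _ = ξ * m := by field_simp
        · simp only [Prod.smul_snd, smul_eq_mul, abs_mul, abs_of_pos hη]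
          gcongr
          exact hD.abs_snd_le _ hz

lemma box (hD : InscribedInBox D m n) (hm : 0 < m) (hn : 0 < n) {ξ η : ℝ} (hξ0 : 0 ≤ ξ)
    (hξ1 : ξ ≤ 1) (hη0 : 0 ≤ η) (hη1 : η ≤ 1) :
    ENNReal.ofReal (ξ * η) * volume D ≤ volume (D ∩ {z | |z.1| ≤ ξ * m ∧ |z.2| ≤ η * n}) := by
  rcases le_total ξ η with h | h
  · exact hD.box_aux hm hξ0 h hη1
  · have hs : MeasurePreserving (Prod.swap : ℝ × ℝ → ℝ × ℝ) volume volume :=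
      Measure.measurePreserving_swap
    have mD := hD.isCompact.measurableSet
    have := hD.swap.box_aux hn hη0 h hξ1
    rw [hs.measure_preimage mD.nullMeasurableSet] at this
    have mB : MeasurableSet (D ∩ {z | |z.1| ≤ ξ * m ∧ |z.2| ≤ η * n}) :=
      mD.inter ((measurableSet_le (by fun_prop : Measurable fun z : ℝ × ℝ => |z.1|)
        measurable_const).inter (measurableSet_le (by fun_prop : Measurable fun z : ℝ × ℝ => |z.2|)
        measurable_const))
    rw [← hs.measure_preimage mB.nullMeasurableSet, mul_comm ξ η]
    refine this.trans (measure_mono ?_)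
    rintro z ⟨h1, h2, h3⟩
    exact ⟨h1, h3, h2⟩

end InscribedInBox

lemma integral_max_cos_sin {a b : ℝ} (ha : 0 ≤ a) (hb : 0 ≤ b) :
    ∫ θ in (0 : ℝ)..(π / 2), max (a * cos θ) (b * sin θ) = √(a ^ 2 + b ^ 2) := by
  set r := √(a ^ 2 + b ^ 2) with hr
  have hr2 : r ^ 2 = a ^ 2 + b ^ 2 := Real.sq_sqrt (by positivity)
  rcases (Real.sqrt_nonneg (a ^ 2 + b ^ 2)).eq_or_lt with h0 | hpos
  · rw [← hr] at h0
    have ha0 : a = 0 := by nlinarith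
    have hb0 : b = 0 := by nlinarith
    simp [ha0, hb0, ← h0]
  rw [← hr] at hpos
  set φ := arcsin (a / r) with hφ
  have har : a / r ≤ 1 := (div_le_one hpos).2 (by nlinarith)
  have hsin : r * sin φ = a := by
    rw [hφ, sin_arcsin (by linarith [div_nonneg ha hpos.le]) har]; field_simp
  have hcos : r * cos φ = b := by
    have h1 : 0 ≤ r * cos φ := mul_nonneg hpos.le (cos_arcsin_nonneg _)
    have h2 : (r * cos φ) ^ 2 = b ^ 2 := by
      have := sin_sq_add_cos_sq φ
      nlinarith
    nlinarith
  have hφ0 : 0 ≤ φ := arcsin_nonneg.2 (div_nonneg ha hpos.le)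
  have hφ1 : φ ≤ π / 2 := arcsin_le_pi_div_two _
  have hint : ∀ c d : ℝ, IntervalIntegrable
      (fun θ => max (a * cos θ) (b * sin θ)) volume c d := fun c d =>
    (by fun_prop : Continuous fun θ => max (a * cos θ) (b * sin θ)).intervalIntegrable _ _
  have hdiff : ∀ θ, a * cos θ - b * sin θ = r * sin (φ - θ) := fun θ => by
    rw [sin_sub, ← hsin, ← hcos]; ring
  rw [← intervalIntegral.integral_add_adjacent_intervals (hint 0 φ) (hint φ (π / 2))]
  have e1 : ∫ θ in (0 : ℝ)..φ, max (a * cos θ) (b * sin θ) = ∫ θ in (0 : ℝ)..φ, a * cos θ := by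
    refine intervalIntegral.integral_congr fun θ hθ => max_eq_left ?_
    rw [Set.uIcc_of_le hφ0] at hθ
    have := sin_nonneg_of_nonneg_of_le_pi (x := φ - θ) (by linarith [hθ.2])
      (by linarith [hθ.1, pi_pos])
    nlinarith [hdiff θ, mul_nonneg hpos.le this]
  have e2 : ∫ θ in φ..(π / 2), max (a * cos θ) (b * sin θ) = ∫ θ in φ..(π / 2), b * sin θ := by
    refine intervalIntegral.integral_congr fun θ hθ => max_eq_right ?_
    rw [Set.uIcc_of_le hφ1] at hθ
    have := sin_nonpos_of_nonpos_of_neg_pi_le (x := φ - θ) (by linarith [hθ.1])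
      (by linarith [hθ.2, pi_pos])
    nlinarith [hdiff θ, mul_nonneg hpos.le (neg_nonneg.2 this)]
  rw [e1, e2, intervalIntegral.integral_const_mul, intervalIntegral.integral_const_mul,
    integral_cos, integral_sin, sin_zero, cos_pi_div_two, sub_zero, sub_zero]
  have : r * (a * sin φ + b * cos φ) = r * r := by nlinarith
  exact mul_left_cancel₀ hpos.ne' this

lemma ofReal_sqrt_eq_lintegral_max (x y : ℝ) :
    ENNReal.ofReal √(x ^ 2 + y ^ 2) =
      ∫⁻ θ in Set.Ioo 0 (π / 2), ENNReal.ofReal (max (cos θ * |x|) (sin θ * |y|)) := by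
  rw [← sq_abs x, ← sq_abs y, ← integral_max_cos_sin (abs_nonneg x) (abs_nonneg y),
    intervalIntegral.integral_of_le (by positivity), integral_Ioc_eq_integral_Ioo,
    ofReal_integral_eq_lintegral_ofReal]
  · simp only [mul_comm]
  · have : Continuous fun θ => max (|x| * cos θ) (|y| * sin θ) := by fun_prop
    exact (this.integrableOn_Icc (a := 0) (b := π / 2)).mono_set Set.Ioo_subset_Icc_self
  · filter_upwards [ae_restrict_mem measurableSet_Ioo] with θ hθ
    exact le_max_of_le_left (mul_nonneg (abs_nonneg _)
      (cos_nonneg_of_mem_Icc ⟨by linarith [hθ.1, pi_pos], hθ.2.le⟩))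

lemma sqrt_add_sqrt_le {a b c d : ℝ} (ha : 0 ≤ a) (hb : 0 ≤ b) (hc : 0 ≤ c) (hd : 0 ≤ d)
    (hadd : a + b ≤ c + d) (hmul : a * b ≤ c * d) : √a + √b ≤ √c + √d := by
  refine abs_le_of_sq_le_sq' ?_ (by positivity) |>.2
  have h := Real.sqrt_le_sqrt hmul
  rw [Real.sqrt_mul ha, Real.sqrt_mul hc] at h
  nlinarith [Real.sq_sqrt ha, Real.sq_sqrt hb, Real.sq_sqrt hc, Real.sq_sqrt hd]

/-- Elongating a rectangle increases the mean distance to a corner (in symmetrized form). -/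
lemma sqrt_add_sqrt_swap_le {m n w k : ℝ} (hm : 0 ≤ m) (hn : 0 ≤ n) (hmw : m ≤ w) (hnw : n ≤ w)
    (hw : 0 < w) (hmul : m * n ≤ w * k) (s t : ℝ) :
    √((m * s) ^ 2 + (n * t) ^ 2) + √((m * t) ^ 2 + (n * s) ^ 2) ≤
      √((w * s) ^ 2 + (k * t) ^ 2) + √((w * t) ^ 2 + (k * s) ^ 2) := by
  have hk : 0 ≤ k := by
    by_contra! h
    nlinarith [mul_nonneg hm hn]
  have hP : (m * n) ^ 2 ≤ (w * k) ^ 2 := by gcongr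
  have hm2 : m ^ 2 ≤ w ^ 2 := by gcongr
  have hn2 : n ^ 2 ≤ w ^ 2 := by gcongr
  have hS : m ^ 2 + n ^ 2 ≤ w ^ 2 + k ^ 2 := by
    have h1 : 0 ≤ (w ^ 2 - m ^ 2) * (w ^ 2 - n ^ 2) :=
      mul_nonneg (by linarith) (by linarith)
    have h2 : 0 < w ^ 2 := by positivity
    by_contra! h
    nlinarith
  refine sqrt_add_sqrt_le (by positivity) (by positivity) (by positivity) (by positivity) ?_ ?_
  · nlinarith [mul_le_mul_of_nonneg_right hS (by positivity : 0 ≤ s ^ 2 + t ^ 2)]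
  · have h1 : (m ^ 2 + n ^ 2) ^ 2 ≤ (w ^ 2 + k ^ 2) ^ 2 := by gcongr
    nlinarith [mul_le_mul_of_nonneg_right h1 (by positivity : 0 ≤ s ^ 2 * t ^ 2),
      mul_le_mul_of_nonneg_right hP (sq_nonneg (s ^ 2 - t ^ 2))]

/-- The mean distance to a corner of a rectangle with sides `m` and `n`. -/
noncomputable def cornerMean (m n : ℝ) : ENNReal :=
  ∫⁻ z in Set.Icc (0 : ℝ) 1 ×ˢ Set.Icc (0 : ℝ) 1, ENNReal.ofReal √((m * z.1) ^ 2 + (n * z.2) ^ 2)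

lemma cornerMean_comm (m n : ℝ) :
    cornerMean m n = ∫⁻ z in Set.Icc (0 : ℝ) 1 ×ˢ Set.Icc (0 : ℝ) 1,
      ENNReal.ofReal √((m * z.2) ^ 2 + (n * z.1) ^ 2) := by
  have hs : MeasurePreserving (Prod.swap : ℝ × ℝ → ℝ × ℝ) volume volume :=
    Measure.measurePreserving_swap
  rw [cornerMean, ← hs.setLIntegral_comp_preimage (measurableSet_Icc.prod measurableSet_Icc)
    (by fun_prop), Set.preimage_swap_prod]
  rfl

lemma cornerMean_le {m n w k : ℝ} (hm : 0 ≤ m) (hn : 0 ≤ n) (hmw : m ≤ w) (hnw : n ≤ w)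
    (hw : 0 < w) (hmul : m * n ≤ w * k) : cornerMean m n ≤ cornerMean w k := by
  have two : ∀ m n : ℝ, 2 * cornerMean m n =
      ∫⁻ z in Set.Icc (0 : ℝ) 1 ×ˢ Set.Icc (0 : ℝ) 1, ENNReal.ofReal
        (√((m * z.1) ^ 2 + (n * z.2) ^ 2) + √((m * z.2) ^ 2 + (n * z.1) ^ 2)) := fun m n => by
    rw [two_mul]
    nth_rewrite 2 [cornerMean_comm]
    rw [cornerMean, ← lintegral_add_left (by fun_prop)]
    refine lintegral_congr fun z => ?_
    rw [ENNReal.ofReal_add (by positivity) (by positivity)]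
  rw [← ENNReal.mul_le_mul_iff_right two_ne_zero ENNReal.ofNat_ne_top, two, two]
  exact lintegral_mono fun z =>
    ENNReal.ofReal_le_ofReal (sqrt_add_sqrt_swap_le hm hn hmw hnw hw hmul _ _)

lemma integral_sqrt_sq_add_sq_s8 {a k : ℝ} (ha : 0 < a) (hk : 0 < k) :
    ∫ t in (0 : ℝ)..1, √(a ^ 2 + (k * t) ^ 2) =
      1 / 2 * (√(a ^ 2 + k ^ 2) + a ^ 2 / k * (log (√(a ^ 2 + k ^ 2) + k) - log a)) := by
  have hd : ∀ t ∈ Set.Ioo (0 : ℝ) 1, HasDerivAt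
      (fun t => 1 / 2 * (t * √(a ^ 2 + (k * t) ^ 2)
        + a ^ 2 / k * log (√(a ^ 2 + (k * t) ^ 2) + k * t)))
      (√(a ^ 2 + (k * t) ^ 2)) t := by
    intro t ht
    have hq : 0 < a ^ 2 + (k * t) ^ 2 := by positivity
    have hR2 := Real.sq_sqrt hq.le
    have hR : 0 < √(a ^ 2 + (k * t) ^ 2) := Real.sqrt_pos.2 hq
    have hkt : 0 < k * t := mul_pos hk ht.1
    have d0 : HasDerivAt (fun t => k * t) k t := by simpa using (hasDerivAt_id t).const_mul k
    have d1 : HasDerivAt (fun t => √(a ^ 2 + (k * t) ^ 2))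
        (k * (k * t) / √(a ^ 2 + (k * t) ^ 2)) t :=
      (((d0.fun_pow 2).const_add (a ^ 2)).sqrt hq.ne').congr_deriv (by field_simp; push_cast; ring)
    have d2 : HasDerivAt (fun t => log (√(a ^ 2 + (k * t) ^ 2) + k * t))
        (k / √(a ^ 2 + (k * t) ^ 2)) t :=
      ((d1.fun_add d0).log (by positivity)).congr_deriv (by field_simp; ring)
    refine ((((hasDerivAt_id' t).fun_mul d1).fun_add (d2.const_mul (a ^ 2 / k))).const_mul
      (1 / 2)).congr_deriv ?_
    set R := √(a ^ 2 + (k * t) ^ 2)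
    field_simp
    linear_combination (-1) * hR2
  have hc : Continuous fun t => √(a ^ 2 + (k * t) ^ 2) := by fun_prop
  rw [intervalIntegral.integral_eq_sub_of_hasDerivAt_of_le zero_le_one _ hd
    (hc.intervalIntegrable _ _)]
  · simp [Real.sqrt_sq ha.le]; ring
  · have hne : ∀ t ∈ Set.Icc (0 : ℝ) 1, √(a ^ 2 + (k * t) ^ 2) + k * t ≠ 0 := fun t ht => by
      have h1 : 0 < √(a ^ 2 + (k * t) ^ 2) := Real.sqrt_pos.2 (by positivity)
      have h2 : 0 ≤ k * t := mul_nonneg hk.le ht.1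
      positivity
    fun_prop (disch := assumption)

lemma integral_integral_sqrt_s8 {w k : ℝ} (hw : 0 < w) (hk : 0 < k) :
    ∫ s in (0 : ℝ)..1, ∫ t in (0 : ℝ)..1, √((w * s) ^ 2 + (k * t) ^ 2) =
      2 / (w * k) * FWrect w k := by
  have hd : ∀ s ∈ Set.Ioo (0 : ℝ) 1, HasDerivAt
      (fun s => 1 / (w * k) * (1 / 3 * k * (w * s) * √((w * s) ^ 2 + k ^ 2)
        + 1 / 6 * ((w * s) ^ 3 * log (√((w * s) ^ 2 + k ^ 2) + k)
          - (w * s) ^ 2 * (w * s * log (w * s)))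
        + 1 / 6 * k ^ 3 * log (√((w * s) ^ 2 + k ^ 2) + w * s)))
      (∫ t in (0 : ℝ)..1, √((w * s) ^ 2 + (k * t) ^ 2)) s := by
    intro s hs
    have hx : 0 < w * s := mul_pos hw hs.1
    rw [integral_sqrt_sq_add_sq_s8 hx hk]
    have hq : 0 < (w * s) ^ 2 + k ^ 2 := by positivity
    have hR2 := Real.sq_sqrt hq.le
    have hR : 0 < √((w * s) ^ 2 + k ^ 2) := Real.sqrt_pos.2 hq
    have d0 : HasDerivAt (fun s => w * s) w s := by simpa using (hasDerivAt_id s).const_mul w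
    have d1 : HasDerivAt (fun s => √((w * s) ^ 2 + k ^ 2))
        (w * (w * s) / √((w * s) ^ 2 + k ^ 2)) s :=
      (((d0.fun_pow 2).add_const (k ^ 2)).sqrt hq.ne').congr_deriv (by field_simp; push_cast; ring)
    have d2 : HasDerivAt (fun s => log (√((w * s) ^ 2 + k ^ 2) + w * s))
        (w / √((w * s) ^ 2 + k ^ 2)) s :=
      ((d1.fun_add d0).log (by positivity)).congr_deriv (by field_simp; ring)
    have d3 : HasDerivAt (fun s => log (√((w * s) ^ 2 + k ^ 2) + k))
        (w * (√((w * s) ^ 2 + k ^ 2) - k) / (√((w * s) ^ 2 + k ^ 2) * (w * s))) s := by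
      refine ((d1.add_const k).log (by positivity)).congr_deriv ?_
      generalize √((w * s) ^ 2 + k ^ 2) = R at *
      generalize w * s = x at *
      field_simp
      linear_combination (-1) * hR2
    refine (((((d0.const_mul (1 / 3 * k)).fun_mul d1).fun_add
      ((((d0.fun_pow 3).fun_mul d3).fun_sub
        ((d0.fun_pow 2).fun_mul (d0.fun_mul (d0.log hx.ne')))).const_mul (1 / 6))).fun_add
      (d2.const_mul (1 / 6 * k ^ 3))).const_mul (1 / (w * k))).congr_deriv ?_
    generalize √((w * s) ^ 2 + k ^ 2) = R at *
    generalize w * s = x at *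
    generalize log (R + k) = L1
    generalize log x = L2
    field_simp
    push_cast
    ring_nf
    linear_combination (-6 * k) * hR2
  have hc : Continuous fun s => ∫ t in (0 : ℝ)..1, √((w * s) ^ 2 + (k * t) ^ 2) := by
    fun_prop
  rw [intervalIntegral.integral_eq_sub_of_hasDerivAt_of_le zero_le_one _ hd
    (hc.intervalIntegrable _ _)]
  · have h1 : 0 < √(w ^ 2 + k ^ 2) := Real.sqrt_pos.2 (by positivity)
    rw [FWrect, add_comm (k ^ 2), log_div (by positivity) hw.ne', log_div (by positivity) hk.ne']
    simp [Real.sqrt_sq hk.le]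
    field_simp
    ring
  · have hne : ∀ s ∈ Set.Icc (0 : ℝ) 1, √((w * s) ^ 2 + k ^ 2) + w * s ≠ 0 := fun s hs => by
      have h1 : 0 < √((w * s) ^ 2 + k ^ 2) := Real.sqrt_pos.2 (by positivity)
      have h2 : 0 ≤ w * s := mul_nonneg hw.le hs.1
      positivity
    have hne' : ∀ s ∈ Set.Icc (0 : ℝ) 1, √((w * s) ^ 2 + k ^ 2) + k ≠ 0 := fun s _ => by
      positivity
    have hlog : Continuous fun s : ℝ => w * s * log (w * s) :=
      continuous_mul_log.comp (continuous_const_mul w)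
    fun_prop (disch := assumption)

lemma cornerMean_eq {w k : ℝ} (hw : 0 < w) (hk : 0 < k) :
    cornerMean w k = ENNReal.ofReal (2 / (w * k) * FWrect w k) := by
  rw [← integral_integral_sqrt_s8 hw hk, intervalIntegral.integral_of_le zero_le_one]
  simp_rw [intervalIntegral.integral_of_le (zero_le_one' ℝ)]
  simp_rw [← integral_Icc_eq_integral_Ioc]
  have hi : IntegrableOn (fun z : ℝ × ℝ => √((w * z.1) ^ 2 + (k * z.2) ^ 2))
      (Set.Icc 0 1 ×ˢ Set.Icc 0 1) :=
    (by fun_prop : Continuous fun z : ℝ × ℝ => √((w * z.1) ^ 2 + (k * z.2) ^ 2)).continuousOn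
      |>.integrableOn_compact (isCompact_Icc.prod isCompact_Icc)
  rw [cornerMean, ← ofReal_integral_eq_lintegral_ofReal hi
    (Filter.Eventually.of_forall fun _ => Real.sqrt_nonneg _), Measure.volume_eq_prod,
    setIntegral_prod _ hi]
namespace InscribedInBox

variable {D : Set (ℝ × ℝ)} {m n : ℝ}

lemma lintegral_max_le (hD : InscribedInBox D m n) (hm : 0 < m) (hn : 0 < n) {α β : ℝ}
    (hα : 0 < α) (hβ : 0 < β) :
    ∫⁻ z in D, ENNReal.ofReal (max (α * |z.1|) (β * |z.2|)) ≤
      volume D * ∫⁻ z in Set.Icc (0 : ℝ) 1 ×ˢ Set.Icc (0 : ℝ) 1,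
        ENNReal.ofReal (max (α * |m * z.1|) (β * |n * z.2|)) := by
  have mD := hD.isCompact.measurableSet
  have fD : volume D ≠ ⊤ := hD.isCompact.measure_ne_top
  set Q : Set (ℝ × ℝ) := Set.Icc (0 : ℝ) 1 ×ˢ Set.Icc (0 : ℝ) 1 with hQ
  have mQ : MeasurableSet Q := measurableSet_Icc.prod measurableSet_Icc
  have vol : ∀ ξ η : ℝ, volume (Set.Icc (0 : ℝ) ξ ×ˢ Set.Icc (0 : ℝ) η) =
      ENNReal.ofReal ξ * ENNReal.ofReal η := fun ξ η => by
    rw [Measure.volume_eq_prod, Measure.prod_prod]; simp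
  have vQ : volume Q = 1 := by rw [hQ, vol]; simp
  have c1 : Continuous fun z : ℝ × ℝ => max (α * |z.1|) (β * |z.2|) := by fun_prop
  have c2 : Continuous fun z : ℝ × ℝ => max (α * |m * z.1|) (β * |n * z.2|) := by fun_prop
  rw [lintegral_eq_lintegral_meas_lt _
      (Filter.Eventually.of_forall fun z => le_max_of_le_left (by positivity))
      c1.measurable.aemeasurable,
    lintegral_eq_lintegral_meas_lt _
      (Filter.Eventually.of_forall fun z => le_max_of_le_left (by positivity))
      c2.measurable.aemeasurable, ← lintegral_const_mul' _ _ fD]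
  refine setLIntegral_mono' measurableSet_Ioi fun t ht => ?_
  have ht : 0 < t := ht
  set ξ := min 1 (t / (α * m)) with hξ
  set η := min 1 (t / (β * n)) with hη
  have hξ0 : 0 ≤ ξ := le_min zero_le_one (by positivity)
  have hη0 : 0 ≤ η := le_min zero_le_one (by positivity)
  have hξt : α * (ξ * m) ≤ t := by
    have h := min_le_right 1 (t / (α * m))
    rw [← hξ, le_div_iff₀ (by positivity)] at h
    linarith
  have hηt : β * (η * n) ≤ t := by
    have h := min_le_right 1 (t / (β * n))
    rw [← hη, le_div_iff₀ (by positivity)] at h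
    linarith
  have upper : volume.restrict D {z | t < max (α * |z.1|) (β * |z.2|)} ≤
      volume D - ENNReal.ofReal (ξ * η) * volume D := by
    have mB : MeasurableSet (D ∩ {z | |z.1| ≤ ξ * m ∧ |z.2| ≤ η * n}) :=
      mD.inter ((measurableSet_le (by fun_prop : Measurable fun z : ℝ × ℝ => |z.1|)
        measurable_const).inter (measurableSet_le (by fun_prop : Measurable fun z : ℝ × ℝ => |z.2|)
        measurable_const))
    rw [Measure.restrict_apply (measurableSet_lt measurable_const c1.measurable)]
    calc _ ≤ volume (D \ (D ∩ {z | |z.1| ≤ ξ * m ∧ |z.2| ≤ η * n})) := by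
          refine measure_mono fun z hz => ⟨hz.2, fun hz' => ?_⟩
          have hlt : t < max (α * |z.1|) (β * |z.2|) := hz.1
          refine (not_le.2 hlt) (max_le ?_ ?_)
          · exact (mul_le_mul_of_nonneg_left hz'.2.1 hα.le).trans hξt
          · exact (mul_le_mul_of_nonneg_left hz'.2.2 hβ.le).trans hηt
      _ = volume D - volume (D ∩ {z | |z.1| ≤ ξ * m ∧ |z.2| ≤ η * n}) :=
          measure_sdiff Set.inter_subset_left mB.nullMeasurableSet
            (measure_ne_top_of_subset Set.inter_subset_left fD)
      _ ≤ _ := tsub_le_tsub_left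
          (hD.box hm hn hξ0 (min_le_left _ _) hη0 (min_le_left _ _)) _
  have lower : 1 - ENNReal.ofReal (ξ * η) ≤
      volume.restrict Q {z | t < max (α * |m * z.1|) (β * |n * z.2|)} := by
    rw [Measure.restrict_apply (measurableSet_lt measurable_const c2.measurable),
      ENNReal.ofReal_mul hξ0, ← vol, ← vQ]
    refine le_measure_sdiff.trans (measure_mono fun z hz => ⟨?_, hz.1⟩)
    obtain ⟨⟨⟨h1, h2⟩, h3, h4⟩, h5⟩ := hz
    rw [Set.mem_ofPred_eq]
    by_contra! h6
    obtain ⟨h7, h8⟩ := max_le_iff.1 h6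
    rw [abs_of_nonneg (mul_nonneg hm.le h1)] at h7
    rw [abs_of_nonneg (mul_nonneg hn.le h3)] at h8
    exact h5 ⟨⟨h1, le_min h2 ((le_div_iff₀ (by positivity)).2 (by linarith))⟩,
      h3, le_min h4 ((le_div_iff₀ (by positivity)).2 (by linarith))⟩
  calc _ ≤ _ := upper
    _ = volume D * (1 - ENNReal.ofReal (ξ * η)) := by
        rw [ENNReal.mul_sub fun _ _ => fD, mul_one, mul_comm (volume D)]
    _ ≤ _ := by gcongr

lemma lintegral_sqrt_le (hD : InscribedInBox D m n) (hm : 0 < m) (hn : 0 < n) :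
    ∫⁻ z in D, ENNReal.ofReal √(z.1 ^ 2 + z.2 ^ 2) ≤ volume D * cornerMean m n := by
  have fD : volume D ≠ ⊤ := hD.isCompact.measure_ne_top
  simp_rw [cornerMean, ofReal_sqrt_eq_lintegral_max]
  have meas : ∀ p q : ℝ, Measurable (Function.uncurry fun (z : ℝ × ℝ) (θ : ℝ) =>
      ENNReal.ofReal (max (cos θ * |p * z.1|) (sin θ * |q * z.2|))) := fun p q => by
    unfold Function.uncurry
    fun_prop
  have swap₁ := lintegral_lintegral_swap (μ := volume.restrict D)
    (ν := volume.restrict (Set.Ioo 0 (π / 2))) (meas 1 1).aemeasurable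
  simp only [one_mul] at swap₁
  rw [swap₁, lintegral_lintegral_swap (meas m n).aemeasurable, ← lintegral_const_mul' _ _ fD]
  refine setLIntegral_mono' measurableSet_Ioo fun θ hθ => ?_
  exact hD.lintegral_max_le hm hn (cos_pos_of_mem_Ioo ⟨by linarith [hθ.1, pi_pos], hθ.2⟩)
    (sin_pos_of_pos_of_lt_pi hθ.1 (by linarith [hθ.2, pi_pos]))

lemma le_volume_slice (hD : InscribedInBox D m n) {y y' a : ℝ} (hl : (-m, y) ∈ D)
    (hr : (m, y) ∈ D) (ha : (a, y') ∈ D) {t : ℝ} (ht0 : 0 ≤ t) (ht1 : t ≤ 1) :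
    ENNReal.ofReal ((1 - t) * (2 * m)) ≤ volume ((fun x => (x, y + t * (y' - y))) ⁻¹' D) := by
  have comb : ∀ x, (x, y) ∈ D → ((1 - t) * x + t * a, y + t * (y' - y)) ∈ D := fun x hx => by
    convert hD.convex hx ha (sub_nonneg.2 ht1) ht0 (by ring) using 1
    ext <;> simp
    ring
  have hc : Convex ℝ ((fun x => (x, y + t * (y' - y))) ⁻¹' D) := by
    intro u hu v hv p q hp hq hpq
    have := hD.convex hu hv hp hq hpq
    rw [Set.mem_preimage]
    convert this using 1
    ext
    · simp
    · simp [← add_mul, hpq]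
  calc _ = volume (Set.Icc ((1 - t) * -m + t * a) ((1 - t) * m + t * a)) := by
        rw [Real.volume_Icc]; ring_nf
    _ ≤ _ := measure_mono (hc.ordConnected.out (comb _ hl) (comb _ hr))

lemma le_volume (hD : InscribedInBox D m n) {y : ℝ} (hl : (-m, y) ∈ D)
    (hr : (m, y) ∈ D) (hm : 0 < m) : ENNReal.ofReal (2 * (m * n)) ≤ volume D := by
  obtain ⟨b, hb⟩ := hD.bottom
  obtain ⟨a, ha⟩ := hD.top
  obtain ⟨h1, h2⟩ := abs_le.1 (hD.abs_snd_le _ hl)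
  simp only at h1 h2
  have lin : ∀ c p q : ℝ, ∫ v in p..q, 2 * m * (v - c) = m * ((q - c) ^ 2 - (p - c) ^ 2) := by
    intro c p q
    rw [intervalIntegral.integral_const_mul, intervalIntegral.integral_sub (by simp) (by simp)]
    simp
    ring
  have piece : ∀ p q c d : ℝ, p ≤ q → (∀ v ∈ Set.Ioc p q, 0 ≤ (v - c) / d) →
      (∀ v ∈ Set.Ioc p q, ENNReal.ofReal (2 * m * (v - c) / d) ≤ volume ((fun x => (x, v)) ⁻¹' D)) →
      ENNReal.ofReal (m * ((q - c) ^ 2 - (p - c) ^ 2) / d) ≤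
        ∫⁻ v in Set.Ioc p q, volume ((fun x => (x, v)) ⁻¹' D) := by
    intro p q c d hpq h0 h
    rw [← lin, ← intervalIntegral.integral_div, intervalIntegral.integral_of_le hpq,
      ofReal_integral_eq_lintegral_ofReal]
    · exact setLIntegral_mono' measurableSet_Ioc h
    · exact ((by fun_prop : Continuous fun v => 2 * m * (v - c) / d).integrableOn_Icc
        (a := p) (b := q)).mono_set Set.Ioc_subset_Icc_self
    · filter_upwards [ae_restrict_mem measurableSet_Ioc] with v hv
      rw [mul_div_assoc]
      exact mul_nonneg (by positivity) (h0 v hv)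
  have low : ENNReal.ofReal (m * (y + n)) ≤
      ∫⁻ v in Set.Ioc (-n) y, volume ((fun x => (x, v)) ⁻¹' D) := by
    rcases h1.eq_or_lt with h | h
    · simp [← h]
    convert piece (-n) y (-n) (y + n) h1 (fun v hv => div_nonneg (by linarith [hv.1])
      (by linarith)) (fun v hv => ?_) using 2
    · have : y + n ≠ 0 := by linarith
      field_simp; ring
    · have hp : 0 < y + n := by linarith
      have := hD.le_volume_slice hl hr hb (t := (y - v) / (y + n))
        (div_nonneg (by linarith [hv.2]) hp.le) ((div_le_one hp).2 (by linarith [hv.1]))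
      convert this using 2
      · field_simp; ring_nf
      · congr 1; ext x; congr 1; field_simp; ring
  have up : ENNReal.ofReal (m * (n - y)) ≤
      ∫⁻ v in Set.Ioc y n, volume ((fun x => (x, v)) ⁻¹' D) := by
    rcases h2.eq_or_lt with h | h
    · simp [← h]
    have hp : 0 < n - y := by linarith
    convert piece y n n (-(n - y)) h2 (fun v hv => div_nonneg_of_nonpos (by linarith [hv.2])
      (by linarith)) (fun v hv => ?_) using 2
    · field_simp; ring
    · have := hD.le_volume_slice hl hr ha (t := (v - y) / (n - y))
        (div_nonneg (by linarith [hv.1]) hp.le) ((div_le_one hp).2 (by linarith [hv.2]))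
      convert this using 2
      · field_simp; ring_nf
      · congr 1; ext x; congr 1; field_simp; ring
  calc _ = ENNReal.ofReal (m * (y + n)) + ENNReal.ofReal (m * (n - y)) := by
        rw [← ENNReal.ofReal_add (mul_nonneg hm.le (by linarith))
          (mul_nonneg hm.le (by linarith))]
        ring_nf
    _ ≤ _ := add_le_add low up
    _ = ∫⁻ v in Set.Ioc (-n) y ∪ Set.Ioc y n, volume ((fun x => (x, v)) ⁻¹' D) :=
        (lintegral_union measurableSet_Ioc (Set.Ioc_disjoint_Ioc_of_le le_rfl)).symm
    _ ≤ ∫⁻ v, volume ((fun x => (x, v)) ⁻¹' D) := setLIntegral_le_lintegral _ _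
    _ = volume D := by
        rw [Measure.volume_eq_prod, Measure.prod_apply_symm hD.isCompact.measurableSet]

lemma lintegral_sqrt_le_FWrect (hD : InscribedInBox D m n) (hm : 0 < m) (hn : 0 < n) {y : ℝ}
    (hl : (-m, y) ∈ D) (hr : (m, y) ∈ D) {w A : ℝ} (hmw : 2 * m ≤ w) (hnw : 2 * n ≤ w)
    (hA : volume D = ENNReal.ofReal A) (hA0 : 0 < A) :
    ∫⁻ z in D, ENNReal.ofReal √(z.1 ^ 2 + z.2 ^ 2) ≤
      ENNReal.ofReal (1 / 2 * FWrect w (2 * A / w)) := by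
  have hw : 0 < w := by linarith
  have hv := hD.le_volume hl hr hm
  rw [hA, ENNReal.ofReal_le_ofReal_iff hA0.le] at hv
  have half : ∀ w k : ℝ, 2 * cornerMean (w / 2) (k / 2) = cornerMean w k := fun w k => by
    rw [cornerMean, cornerMean, ← lintegral_const_mul' _ _ ENNReal.ofNat_ne_top]
    refine lintegral_congr fun z => ?_
    rw [← ENNReal.ofReal_ofNat 2, ← ENNReal.ofReal_mul zero_le_two]
    congr 1
    rw [← Real.sqrt_sq (zero_le_two (α := ℝ)), ← Real.sqrt_mul (by positivity),
      Real.sqrt_sq zero_le_two]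
    congr 1
    ring
  calc _ ≤ volume D * cornerMean m n := hD.lintegral_sqrt_le hm hn
    _ ≤ ENNReal.ofReal A * cornerMean (w / 2) (2 * A / w / 2) := by
        rw [hA]
        gcongr
        refine cornerMean_le hm.le hn.le (by linarith) (by linarith) (by linarith) ?_
        have : w / 2 * (2 * A / w / 2) = A / 2 := by field_simp
        linarith
    _ = ENNReal.ofReal (A / 2) * cornerMean w (2 * A / w) := by
        rw [← half w (2 * A / w), ← mul_assoc]
        congr 1
        rw [← ENNReal.ofReal_ofNat 2, ← ENNReal.ofReal_mul (by positivity)]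
        congr 1
        ring
    _ = _ := by
        rw [cornerMean_eq hw (by positivity), ← ENNReal.ofReal_mul (by positivity)]
        congr 1
        field_simp

end InscribedInBox

/-- The plane `ℝ × ℝ` placed in Euclidean coordinates, with the origin moved to `(p, q)`. -/
noncomputable def planeMap (p q : ℝ) (z : ℝ × ℝ) : EuclideanSpace ℝ (Fin 2) :=
  !₂[z.1 + p, z.2 + q]

lemma measurePreserving_planeMap (p q : ℝ) : MeasurePreserving (planeMap p q) := by
  have h1 := measurePreserving_add_right (volume : Measure (ℝ × ℝ)) (p, q)
  have h2 := (volume_preserving_finTwoArrow ℝ).symm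
  have h3 := PiLp.volume_preserving_toLp (Fin 2)
  exact (h3.comp h2).comp h1

lemma continuous_planeMap (p q : ℝ) : Continuous (planeMap p q) := by
  unfold planeMap
  fun_prop

lemma planeMap_sub (p q : ℝ) (x : EuclideanSpace ℝ (Fin 2)) :
    planeMap p q (x 0 - p, x 1 - q) = x := by
  ext i
  fin_cases i <;> simp [planeMap]

lemma norm_planeMap_sub (p q : ℝ) (z : ℝ × ℝ) :
    ‖planeMap p q z - !₂[p, q]‖ = √(z.1 ^ 2 + z.2 ^ 2) := by
  simp [EuclideanSpace.norm_eq, planeMap]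

lemma convex_preimage_planeMap (p q : ℝ) {C : Set (EuclideanSpace ℝ (Fin 2))} (hC : Convex ℝ C) :
    Convex ℝ (planeMap p q ⁻¹' C) := by
  intro u hu v hv s t hs ht hst
  have := hC hu hv hs ht hst
  rw [Set.mem_preimage]
  convert this using 1
  ext i
  fin_cases i
  · simp [planeMap]
    linear_combination (-p) * hst
  · simp [planeMap]
    linear_combination (-q) * hst

theorem fermat_weber_general_upper_bound (w h : ℝ) (hh : 0 < h) (hwh : h ≤ w)
    (C : Set (EuclideanSpace ℝ (Fin 2))) (hconv : Convex ℝ C)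
    (hsub : C ⊆ {x : EuclideanSpace ℝ (Fin 2) |
      x 0 ∈ Set.Icc 0 w ∧ x 1 ∈ Set.Icc 0 h})
    (A : ℝ) (hA : A = (volume C).toReal) (hApos : 0 < A)
    (hseg : ∃ a b : EuclideanSpace ℝ (Fin 2), a ∈ C ∧ b ∈ C ∧ a 1 = b 1 ∧
      |b 0 - a 0| =
        sSup ((fun x : EuclideanSpace ℝ (Fin 2) => x 0) '' C)
          - sInf ((fun x : EuclideanSpace ℝ (Fin 2) => x 0) '' C)) :
    ∃ p : EuclideanSpace ℝ (Fin 2),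
      ∫ x in C, ‖x - p‖ ∂volume ≤ 1 / 2 * FWrect w (2 * A / w) := by
  have hw : 0 < w := hh.trans_le hwh
  obtain ⟨a, b, ha, hb, hab1, hab⟩ : ∃ a b : EuclideanSpace ℝ (Fin 2), a ∈ C ∧ b ∈ C ∧
      a 1 = b 1 ∧ ∀ x ∈ C, a 0 ≤ x 0 ∧ x 0 ≤ b 0 := by
    obtain ⟨a, b, ha, hb, hab1, hab⟩ := hseg
    have bound : ∀ x ∈ C, sInf ((fun x : EuclideanSpace ℝ (Fin 2) => x 0) '' C) ≤ x 0 ∧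
        x 0 ≤ sSup ((fun x : EuclideanSpace ℝ (Fin 2) => x 0) '' C) := fun x hx =>
      ⟨csInf_le ⟨0, by rintro _ ⟨y, hy, rfl⟩; exact (hsub hy).1.1⟩ ⟨x, hx, rfl⟩,
        le_csSup ⟨w, by rintro _ ⟨y, hy, rfl⟩; exact (hsub hy).1.2⟩ ⟨x, hx, rfl⟩⟩
    have b1 := bound a ha
    have b2 := bound b hb
    rcases abs_cases (b 0 - a 0) with ⟨h1, -⟩ | ⟨h1, -⟩
    · exact ⟨a, b, ha, hb, hab1, fun x hx => by
        have := bound x hx; constructor <;> linarith⟩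
    · exact ⟨b, a, hb, ha, hab1.symm, fun x hx => by
        have := bound x hx; constructor <;> linarith⟩
  set K := closure C with hK
  have hCK : C ⊆ K := subset_closure
  have hKsub : ∀ x ∈ K, (a 0 ≤ x 0 ∧ x 0 ≤ b 0) ∧ 0 ≤ x 1 ∧ x 1 ≤ h := by
    have hcl : IsClosed {x : EuclideanSpace ℝ (Fin 2) |
        (a 0 ≤ x 0 ∧ x 0 ≤ b 0) ∧ 0 ≤ x 1 ∧ x 1 ≤ h} := by
      simp only [Set.ofPred_and]
      refine IsClosed.inter (IsClosed.inter ?_ ?_) (IsClosed.inter ?_ ?_) <;>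
        exact isClosed_le (by fun_prop) (by fun_prop)
    have hsub' : C ⊆ {x : EuclideanSpace ℝ (Fin 2) |
      (a 0 ≤ x 0 ∧ x 0 ≤ b 0) ∧ 0 ≤ x 1 ∧ x 1 ≤ h} := fun y hy => ⟨hab y hy, (hsub hy).2⟩
    exact fun x hx => closure_minimal hsub' hcl hx
  have hKc : IsCompact K := by
    refine ((isCompact_Icc (a := a 0) (b := b 0)).prod (isCompact_Icc (a := 0) (b := h))
      |>.image (continuous_planeMap 0 0)).of_isClosed_subset isClosed_closure fun x hx => ?_
    exact ⟨(x 0 - 0, x 1 - 0), by simpa [and_and_and_comm] using hKsub x hx, planeMap_sub 0 0 x⟩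
  have hKC : K =ᵐ[volume] C := closure_ae_eq_of_null_frontier (hconv.addHaar_frontier volume)
  have hKA : volume K = ENNReal.ofReal A := by
    rw [hA, ← measure_congr hKC, ENNReal.ofReal_toReal hKc.measure_ne_top]
  obtain ⟨c, hc, hcmin⟩ := hKc.exists_isMinOn ⟨a, hCK ha⟩
    (f := fun x : EuclideanSpace ℝ (Fin 2) => x 1) (by fun_prop)
  obtain ⟨d, hd, hdmax⟩ := hKc.exists_isMaxOn ⟨a, hCK ha⟩
    (f := fun x : EuclideanSpace ℝ (Fin 2) => x 1) (by fun_prop)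
  set p := (a 0 + b 0) / 2 with hp
  set q := (c 1 + d 1) / 2 with hq
  set D := planeMap p q ⁻¹' K with hD
  set m := (b 0 - a 0) / 2 with hm
  set n := (d 1 - c 1) / 2 with hn
  have mem : ∀ x ∈ K, (x 0 - p, x 1 - q) ∈ D := fun x hx => by
    rw [hD, Set.mem_preimage, planeMap_sub]
    exact hx
  have hbox : ∀ z ∈ D, |z.1| ≤ m ∧ |z.2| ≤ n := fun z hz => by
    have h1 := hKsub _ hz
    have h2 := hcmin hz
    have h3 := hdmax hz
    simp only [planeMap, Set.mem_ofPred_eq, PiLp.toLp_apply, Matrix.cons_val_zero,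
      Matrix.cons_val_one] at h1 h2 h3
    constructor <;> rw [abs_le] <;> constructor <;> linarith
  have hDsub : D ⊆ Set.Icc (-m) m ×ˢ Set.Icc (-n) n := fun z hz =>
    ⟨abs_le.1 (hbox z hz).1, abs_le.1 (hbox z hz).2⟩
  have hmem_l : (-m, a 1 - q) ∈ D := by
    convert mem a (hCK ha) using 2
    ring
  have hmem_r : (m, a 1 - q) ∈ D := by
    convert mem b (hCK hb) using 2
    · ring
    · rw [hab1]
  have hins : InscribedInBox D m n :=
    { isCompact := (isCompact_Icc.prod isCompact_Icc).of_isClosed_subset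
        (isClosed_closure.preimage (continuous_planeMap p q)) hDsub
      convex := convex_preimage_planeMap p q hconv.closure
      abs_fst_le := fun z hz => (hbox z hz).1
      abs_snd_le := fun z hz => (hbox z hz).2
      left := ⟨_, hmem_l⟩
      right := ⟨_, hmem_r⟩
      bottom := ⟨c 0 - p, by convert mem c hc using 2; ring⟩
      top := ⟨d 0 - p, by convert mem d hd using 2; ring⟩ }
  have mK := hKc.measurableSet
  have hDA : volume D = ENNReal.ofReal A := by
    rw [hD, (measurePreserving_planeMap p q).measure_preimage mK.nullMeasurableSet, hKA]
  have hpos : 0 < ENNReal.ofReal (m - -m) * ENNReal.ofReal (n - -n) := by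
    rw [← Real.volume_Icc, ← Real.volume_Icc, ← Measure.prod_prod, ← Measure.volume_eq_prod]
    exact (hDA ▸ ENNReal.ofReal_pos.2 hApos : 0 < volume D).trans_le (measure_mono hDsub)
  rw [CanonicallyOrderedAdd.mul_pos, ENNReal.ofReal_pos, ENNReal.ofReal_pos] at hpos
  have hab0 := (hsub ha).1.1
  have hb0 := (hsub hb).1.2
  have hc0 := (hKsub c hc).2.1
  have hd0 := (hKsub d hd).2.2
  have main := hins.lintegral_sqrt_le_FWrect (by linarith) (by linarith) hmem_l hmem_r
    (w := w) (by linarith) (by linarith) hDA hApos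
  have hFW : 0 ≤ 1 / 2 * FWrect w (2 * A / w) := by
    have hk : 0 < 2 * A / w := by positivity
    have h0 : 0 ≤ 2 / (w * (2 * A / w)) * FWrect w (2 * A / w) := by
      rw [← integral_integral_sqrt_s8 hw hk]
      exact intervalIntegral.integral_nonneg zero_le_one fun s _ =>
        intervalIntegral.integral_nonneg zero_le_one fun t _ => Real.sqrt_nonneg _
    have := nonneg_of_mul_nonneg_right h0 (by positivity)
    positivity
  refine ⟨!₂[p, q], ?_⟩
  rw [integral_eq_lintegral_of_nonneg_ae (Filter.Eventually.of_forall fun _ => norm_nonneg _)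
    (by fun_prop : Continuous fun x : EuclideanSpace ℝ (Fin 2) =>
      ‖x - !₂[p, q]‖).aestronglyMeasurable]
  refine ENNReal.toReal_le_of_le_ofReal hFW ?_
  rw [← setLIntegral_congr hKC, ← (measurePreserving_planeMap p q).setLIntegral_comp_preimage mK
    (by fun_prop)]
  simp_rw [norm_planeMap_sub]
  exact main
end
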